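/- Almost surely, the positive Radon measure M'(dx) obtained as the weak limit as t → ∞ of the measures M'_t(dx) = (√(2d)·t − X_t(x)) e^{√(2d)·X_t(x) − d·t} dx is atomless: almost surely M'({x}) = 0 for every x ∈ ℝ^d. -/

import Mathlib

open MeasureTheory ProbabilityTheory Filter

noncomputable section


/-- standard Gaussian -/
abbrev gam : Measure ℝ := gaussianReal 0 1

lemma pdf_shift (c s : ℝ) :
    gaussianPDFReal c 1 s = Real.exp (c * s - c ^ 2 / 2) * gaussianPDFReal 0 1 s := by
  simp only [gaussianPDFReal]
  rw [mul_left_comm, ← Real.exp_add]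
  congr 2
  simp
  ring

lemma gauss_tilt (c dd : ℝ) (hc : c ^ 2 = 2 * dd) (φ : ℝ → ENNReal) (hφ : Measurable φ) :
    ∫⁻ s, ENNReal.ofReal (Real.exp (c * s - dd)) * φ s ∂gam = ∫⁻ s, φ (s + c) ∂gam := by
  have h1 : ∫⁻ s, φ (s + c) ∂gam = ∫⁻ s, φ s ∂(gaussianReal c 1) := by
    have := gaussianReal_map_add_const (μ := 0) (v := 1) c
    rw [zero_add] at this
    rw [← this, lintegral_map hφ (by fun_prop)]
  rw [h1, gam, gaussianReal_of_var_ne_zero _ one_ne_zero, gaussianReal_of_var_ne_zero _ one_ne_zero,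
    lintegral_withDensity_eq_lintegral_mul _ (by fun_prop) (by fun_prop),
    lintegral_withDensity_eq_lintegral_mul _ (by fun_prop) (by fun_prop)]
  refine lintegral_congr fun s => ?_
  simp only [Pi.mul_apply, gaussianPDF]
  rw [pdf_shift c s, ← mul_assoc, ← ENNReal.ofReal_mul (gaussianPDFReal_nonneg _ _ _)]
  congr 2
  rw [mul_comm]
  congr 3
  linarith

lemma gauss_shift_integral (v : ℝ) (F : ℝ → ℝ) :
    ∫ s, F (s - v) ∂gam = ∫ s, Real.exp (-v * s - v ^ 2 / 2) * F s ∂gam := by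
  have h1 : ∫ s, F (s - v) ∂gam = ∫ s, F s ∂(gaussianReal (-v) 1) := by
    have := gaussianReal_map_sub_const (μ := 0) (v := 1) v
    rw [zero_sub] at this
    have he : MeasurableEmbedding (fun s : ℝ => s - v) := (MeasurableEquiv.subRight v).measurableEmbedding
    rw [← this, he.integral_map]
  rw [h1, integral_gaussianReal_eq_integral_smul one_ne_zero,
    integral_gaussianReal_eq_integral_smul one_ne_zero]
  refine integral_congr_ae (Eventually.of_forall fun s => ?_)
  simp only [pdf_shift (-v) s, smul_eq_mul]
  ring_nf

lemma mills (κ : ℝ → ℝ) (hκ : Monotone κ) (hintgb : Integrable κ gam) (s0 : ℝ)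
    (hs : ∫ s in Set.Ioi 0, κ s ∂gam ≤ κ s0 * gam.real (Set.Ioi 0)) (v : ℝ) (hv : 0 ≤ v) :
    0 ≤ ∫ s in Set.Ioi v, (κ s0 - κ (s - v)) ∂gam := by
  set F : ℝ → ℝ := (Set.Ioi 0).indicator (fun s => κ s0 - κ s) with hF
  have hFi : Integrable F gam := ((integrable_const _).sub hintgb).indicator measurableSet_Ioi
  have hF0 : 0 ≤ ∫ s, F s ∂gam := by
    rw [hF, integral_indicator measurableSet_Ioi, integral_sub (integrable_const _) hintgb.integrableOn]
    simp only [setIntegral_const, smul_eq_mul]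
    rw [mul_comm]; linarith
  have h1 : ∫ s in Set.Ioi v, (κ s0 - κ (s - v)) ∂gam = ∫ s, F (s - v) ∂gam := by
    rw [← integral_indicator measurableSet_Ioi]
    refine integral_congr_ae (Eventually.of_forall fun s => ?_)
    by_cases h : v < s <;> simp [hF, Set.indicator, h]
  rw [h1, gauss_shift_integral]
  have hm : Measurable F := (measurable_const.sub hκ.measurable).indicator measurableSet_Ioi
  have hb : Integrable (fun s => Real.exp (-v * s - v ^ 2 / 2) * F s) gam := by
    refine hFi.mono (by fun_prop) (Eventually.of_forall fun s => ?_)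
    by_cases h : 0 < s
    · rw [norm_mul]
      refine mul_le_of_le_one_left (norm_nonneg _) ?_
      rw [Real.norm_eq_abs, Real.abs_exp, Real.exp_le_one_iff]
      nlinarith [mul_nonneg hv h.le, sq_nonneg v]
    · simp [hF, h]
  have h2 : ∫ s, Real.exp (-v * s0 - v ^ 2 / 2) * F s ∂gam
      ≤ ∫ s, Real.exp (-v * s - v ^ 2 / 2) * F s ∂gam := by
    refine integral_mono (hFi.const_mul _) hb fun s => ?_
    by_cases h : 0 < s
    · simp only [hF, Set.indicator, Set.mem_Ioi, h, if_true]
      rcases le_total s s0 with hh | hh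
      · refine mul_le_mul_of_nonneg_right (Real.exp_le_exp.2 ?_) (sub_nonneg.2 (hκ hh))
        nlinarith
      · refine mul_le_mul_of_nonpos_right (Real.exp_le_exp.2 ?_) (sub_nonpos.2 (hκ hh))
        nlinarith
    · simp [hF, h]
  refine le_trans ?_ h2
  rw [integral_const_mul]
  positivity

/-- killed Gaussian step operator -/
def G (φ : ℝ → ENNReal) (v : ℝ) : ENNReal :=
  ∫⁻ s, (Set.Ici (0:ℝ)).indicator φ (v - s) ∂gam

lemma Gbound (H : ℝ → ℝ) (hH : ∀ u, 0 ≤ u → 0 ≤ H u) (v : ℝ)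
    (hintgb : Integrable (fun s => H (v - s)) gam)
    (hpos : 0 ≤ ∫ s in Set.Ioi v, H (v - s) ∂gam) :
    G (fun u => ENNReal.ofReal (H u)) v ≤ ENNReal.ofReal (∫ s, H (v - s) ∂gam) := by
  have h1 : G (fun u => ENNReal.ofReal (H u)) v
      = ∫⁻ s in Set.Iic v, ENNReal.ofReal (H (v - s)) ∂gam := by
    rw [G, ← lintegral_indicator measurableSet_Iic]
    refine lintegral_congr fun s => ?_
    by_cases h : s ≤ v <;> simp [Set.indicator, h]
  rw [h1, ← ofReal_integral_eq_lintegral_ofReal hintgb.integrableOn]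
  · refine ENNReal.ofReal_le_ofReal ?_
    have := integral_add_compl (μ := gam) (measurableSet_Iic (a := v)) hintgb
    rw [Set.compl_Iic] at this
    linarith
  · refine (ae_restrict_iff' measurableSet_Iic).2 (Eventually.of_forall fun s hs => ?_)
    exact hH _ (sub_nonneg.2 hs)

lemma gam_Ioi_pos : 0 < gam.real (Set.Ioi 0) := by
  rw [Measure.real, ENNReal.toReal_pos_iff]
  refine ⟨?_, measure_lt_top _ _⟩
  rw [pos_iff_ne_zero]
  intro h
  have := gaussianReal_absolutelyContinuous' 0 (one_ne_zero (α := NNReal)) h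
  simp at this

lemma ex_s0 (κ : ℝ → ℝ) (hκ : Tendsto κ atTop atTop) (B : ℝ) :
    ∃ s0, ∫ s in Set.Ioi 0, κ s ∂gam ≤ κ s0 * gam.real (Set.Ioi 0) ∧ B ≤ κ s0 := by
  have h1 := (hκ.atTop_mul_const gam_Ioi_pos).eventually_ge_atTop (∫ s in Set.Ioi 0, κ s ∂gam)
  obtain ⟨s, h⟩ := (h1.and (hκ.eventually_ge_atTop B)).exists
  exact ⟨s, h⟩

lemma integrable_id_gam : Integrable (fun s : ℝ => s) gam := by
  have := (memLp_id_gaussianReal (μ := 0) (v := 1) 1)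
  exact memLp_one_iff_integrable.1 this

lemma integrable_exp_gam (t : ℝ) : Integrable (fun s : ℝ => Real.exp (t * s)) gam :=
  integrable_exp_mul_gaussianReal t

lemma integral_exp_gam (t : ℝ) : ∫ s, Real.exp (t * s) ∂gam = Real.exp (t ^ 2 / 2) := by
  have := congrFun (mgf_fun_id_gaussianReal (μ := 0) (v := 1)) t
  simpa [mgf] using this

lemma exA1 : ∃ A : ℝ, 1 ≤ A ∧ ∀ v, 0 ≤ v →
    G (fun u => ENNReal.ofReal (u + A)) v ≤ ENNReal.ofReal (v + A) := by
  obtain ⟨A, h1, h2⟩ := ex_s0 (fun s => s) tendsto_id 1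
  refine ⟨A, h2, fun v hv => ?_⟩
  have hi : Integrable (fun s => v - s + A) gam :=
    ((integrable_const _).sub integrable_id_gam).add (integrable_const _)
  refine (Gbound (fun u => u + A) (fun u hu => by linarith) v hi ?_).trans_eq ?_
  · have := mills (fun s => s) monotone_id integrable_id_gam A h1 v hv
    refine this.trans_eq (integral_congr_ae (Eventually.of_forall fun s => ?_))
    simp only; ring
  · have e1 : ∫ s, (v - s + A) ∂gam = (∫ s, (v - s) ∂gam) + ∫ s, A ∂gam :=
      integral_add ((integrable_const _).sub integrable_id_gam) (integrable_const _)
    have e2 : ∫ s, (v - s) ∂gam = (∫ s, v ∂gam) - ∫ s, s ∂gam :=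
      integral_sub (integrable_const _) integrable_id_gam
    have e3 : ∫ s, s ∂gam = 0 := integral_id_gaussianReal
    rw [e1, e2, e3]
    simp

lemma exA2 (θ : ℝ) (hθ : 0 < θ) : ∃ A : ℝ, 1 ≤ A ∧ ∃ ε : ℝ, 0 < ε ∧ ∀ v, 0 ≤ v →
    G (fun u => ENNReal.ofReal (A - Real.exp (-θ * u))) v + ENNReal.ofReal (ε * Real.exp (-θ * v))
      ≤ ENNReal.ofReal (A - Real.exp (-θ * v)) := by
  obtain ⟨s0, h1, h2⟩ := ex_s0 (fun s => Real.exp (θ * s))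
    (Real.tendsto_exp_atTop.comp (tendsto_id.const_mul_atTop hθ)) (Real.exp (θ ^ 2 / 2))
  set A := Real.exp (θ * s0)
  have hA1 : 1 ≤ A := le_trans (Real.one_le_exp (by positivity)) h2
  refine ⟨A, hA1, Real.exp (θ ^ 2 / 2) - 1, by
    have := Real.add_one_lt_exp (x := θ ^ 2 / 2) (by positivity)
    have : 0 < θ ^ 2 / 2 := by positivity
    linarith, fun v hv => ?_⟩
  have he : ∀ s, Real.exp (-θ * (v - s)) = Real.exp (-θ * v) * Real.exp (θ * s) := fun s => by
    rw [← Real.exp_add]; ring_nf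
  have hi : Integrable (fun s => A - Real.exp (-θ * (v - s))) gam := by
    simp_rw [he]
    exact (integrable_const _).sub ((integrable_exp_gam θ).const_mul _)
  have hle1 : Real.exp (-θ * v) ≤ 1 := by
    rw [Real.exp_le_one_iff]; nlinarith
  have hI : ∫ s, (A - Real.exp (-θ * (v - s))) ∂gam
      = A - Real.exp (-θ * v) * Real.exp (θ ^ 2 / 2) := by
    simp_rw [he]
    rw [integral_sub (integrable_const _) ((integrable_exp_gam θ).const_mul _), integral_const_mul,
      integral_exp_gam]
    simp
  have := Gbound (fun u => A - Real.exp (-θ * u)) (fun u hu => by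
    have : Real.exp (-θ * u) ≤ 1 := by rw [Real.exp_le_one_iff]; nlinarith
    linarith) v hi (by
      have := mills (fun s => Real.exp (θ * s))
        (fun a b hab => Real.exp_le_exp.2 (by nlinarith)) (integrable_exp_gam θ) s0 h1 v hv
      refine this.trans_eq (integral_congr_ae (Eventually.of_forall fun s => ?_))
      simp only
      congr 2; ring)
  rw [hI] at this
  refine (add_le_add_left this _).trans ?_
  have hp := Real.exp_pos (-θ * v)
  have hq : 1 ≤ Real.exp (θ ^ 2 / 2) := Real.one_le_exp (by positivity)
  rw [← ENNReal.ofReal_add]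
  · refine ENNReal.ofReal_le_ofReal ?_
    nlinarith
  · nlinarith [Real.exp_pos (θ ^ 2 / 2)]
  · exact mul_nonneg (by linarith) hp.le


lemma G_mono {φ ψ : ℝ → ENNReal} (h : ∀ u, 0 ≤ u → φ u ≤ ψ u) (v : ℝ) : G φ v ≤ G ψ v := by
  refine lintegral_mono fun s => ?_
  exact Set.indicator_le_indicator' (fun hs => h _ hs)

lemma G_meas {φ : ℝ → ENNReal} (h : Measurable φ) : Measurable (G φ) := by
  unfold G
  have : Measurable (fun p : ℝ × ℝ => (Set.Ici (0:ℝ)).indicator φ (p.1 - p.2)) :=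
    (h.indicator measurableSet_Ici).comp (by fun_prop)
  exact this.lintegral_prod_right'

lemma G_add {φ ψ : ℝ → ENNReal} (h : Measurable φ) (v : ℝ) :
    G (fun u => φ u + ψ u) v = G φ v + G ψ v := by
  unfold G
  have hm : Measurable (fun s => (Set.Ici (0:ℝ)).indicator φ (v - s)) :=
    (h.indicator measurableSet_Ici).comp (by fun_prop)
  rw [← lintegral_add_left hm]
  refine lintegral_congr fun s => ?_
  by_cases hs : s ≤ v <;> simp [Set.indicator, hs]

lemma G_const_mul {φ : ℝ → ENNReal} (h : Measurable φ) (a : ENNReal) (v : ℝ) :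
    G (fun u => a * φ u) v = a * G φ v := by
  unfold G
  have hm : Measurable (fun s => (Set.Ici (0:ℝ)).indicator φ (v - s)) :=
    (h.indicator measurableSet_Ici).comp (by fun_prop)
  rw [← lintegral_const_mul _ hm]
  refine lintegral_congr fun s => ?_
  by_cases hs : s ≤ v <;> simp [Set.indicator, hs]

lemma Gn_meas {φ : ℝ → ENNReal} (h : Measurable φ) (n : ℕ) : Measurable (G^[n] φ) := by
  induction n with
  | zero => exact h
  | succ n ih => rw [Function.iterate_succ']; exact G_meas ih

lemma Gn_mono {φ ψ : ℝ → ENNReal} (h : ∀ u, 0 ≤ u → φ u ≤ ψ u) (n : ℕ) :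
    ∀ v, 0 ≤ v → G^[n] φ v ≤ G^[n] ψ v := by
  induction n with
  | zero => exact h
  | succ n ih =>
    intro v _
    rw [Function.iterate_succ']
    exact G_mono ih v

lemma Gn_add {φ ψ : ℝ → ENNReal} (h : Measurable φ) (n : ℕ) :
    G^[n] (fun u => φ u + ψ u) = fun v => G^[n] φ v + G^[n] ψ v := by
  induction n with
  | zero => rfl
  | succ n ih =>
    rw [Function.iterate_succ', Function.comp_apply, ih]
    funext v
    rw [G_add (Gn_meas h n)]; rfl

lemma Gn_const_mul {φ : ℝ → ENNReal} (h : Measurable φ) (a : ENNReal) (n : ℕ) :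
    G^[n] (fun u => a * φ u) = fun v => a * G^[n] φ v := by
  induction n with
  | zero => rfl
  | succ n ih =>
    rw [Function.iterate_succ', Function.comp_apply, ih]
    funext v
    rw [G_const_mul (Gn_meas h n)]; rfl

lemma Gn_super {ψ : ℝ → ENNReal} (h : ∀ u, 0 ≤ u → G ψ u ≤ ψ u) (n : ℕ) :
    ∀ v, 0 ≤ v → G^[n] ψ v ≤ ψ v := by
  induction n with
  | zero => intro v _; exact le_rfl
  | succ n ih =>
    intro v hv
    rw [Function.iterate_succ']
    exact (G_mono ih v).trans (h v hv)

lemma potential {φ ψ : ℝ → ENNReal} (hφ : Measurable φ)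
    (h : ∀ u, 0 ≤ u → G ψ u + φ u ≤ ψ u) (M : ℕ) (b : ℝ) (hb : 0 ≤ b) :
    ∑' m, (if M ≤ m then G^[m] φ b else 0) ≤ G^[M] ψ b := by
  have key : ∀ K, ∑ m ∈ Finset.range K, (if M ≤ m then G^[m] φ b else 0) + G^[max M K] ψ b
      ≤ G^[M] ψ b := by
    intro K
    induction K with
    | zero => simp
    | succ K ih =>
      rw [Finset.sum_range_succ]
      by_cases hM : M ≤ K
      · rw [max_eq_right hM] at ih
        rw [max_eq_right (by omega), if_pos hM, add_assoc]
        refine le_trans ?_ ih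
        gcongr
        have h1 := Gn_mono h K b hb
        rw [show (fun u => G ψ u + φ u) = fun u => φ u + G ψ u by funext u; rw [add_comm],
          Gn_add hφ] at h1
        rwa [Function.iterate_succ]
      · rw [max_eq_left (by omega)] at ih ⊢
        simpa [hM] using ih
  rw [ENNReal.tsum_eq_iSup_nat]
  exact iSup_le fun K => le_trans le_self_add (key K)

lemma gauss_half (v : NNReal) (hv : v ≠ 0) : gaussianReal 0 v (Set.Iic 0) = ENNReal.ofReal (1/2) := by
  have := nullSingletonClass_gaussianReal (μ := 0) hv
  have h1 : gaussianReal 0 v (Set.Ici 0) = gaussianReal 0 v (Set.Iic 0) := by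
    have := gaussianReal_map_neg (μ := 0) (v := v)
    rw [neg_zero] at this
    conv_lhs => rw [← this]
    rw [Measure.map_apply (by fun_prop) measurableSet_Ici]
    congr 1
    ext x; simp
  have h2 : gaussianReal 0 v (Set.Iic 0) + gaussianReal 0 v (Set.Ioi 0) = 1 := by
    rw [← Set.compl_Iic, measure_add_measure_compl measurableSet_Iic, measure_univ]
  rw [measure_congr (Ioi_ae_eq_Ici (μ := gaussianReal 0 v)), h1] at h2
  have h3 : (gaussianReal 0 v (Set.Iic 0)).toReal = 1/2 := by
    have := congrArg ENNReal.toReal h2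
    rw [ENNReal.toReal_add (measure_ne_top _ _) (measure_ne_top _ _)] at this
    simp at this; linarith
  rw [← h3, ENNReal.ofReal_toReal (measure_ne_top _ _)]

lemma gauss_cdf (n : ℕ) (hn : 0 < n) (u : ℝ) (hu : 0 ≤ u) :
    gaussianReal 0 (n : NNReal) (Set.Iic u) ≤ ENNReal.ofReal (1/2) + ENNReal.ofReal (u / √n) := by
  have hv : (n : NNReal) ≠ 0 := by exact_mod_cast hn.ne'
  have h0 : Set.Iic u = Set.Iic 0 ∪ Set.Ioc 0 u := (Set.Iic_union_Ioc_eq_Iic hu).symm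
  rw [h0]
  refine (measure_union_le _ _).trans ?_
  rw [gauss_half _ hv]
  gcongr
  rw [gaussianReal_apply _ hv]
  have hb : ∀ x, gaussianPDF 0 (n : NNReal) x ≤ ENNReal.ofReal (1 / √n) := by
    intro x
    refine ENNReal.ofReal_le_ofReal ?_
    simp only [gaussianPDFReal]
    have hn' : (0:ℝ) < n := by exact_mod_cast hn
    have e1 : Real.exp (-(x - 0) ^ 2 / (2 * ((n : NNReal) : ℝ))) ≤ 1 := by
      rw [Real.exp_le_one_iff]
      apply div_nonpos_of_nonpos_of_nonneg <;> [nlinarith [sq_nonneg (x - 0)]; positivity]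
    refine (mul_le_of_le_one_right (by positivity) e1).trans ?_
    rw [one_div]
    gcongr
    push_cast
    nlinarith [Real.pi_gt_three]
  refine (lintegral_mono hb).trans ?_
  rw [setLIntegral_const, Real.volume_Ioc, ← ENNReal.ofReal_mul (by positivity)]
  apply le_of_eq; congr 1; ring

lemma Gn_one_le (n : ℕ) : ∀ v, 0 ≤ v →
    G^[n] (fun _ => 1) v ≤ gaussianReal 0 (n : NNReal) (Set.Iic v) := by
  induction n with
  | zero => intro v hv; simp [hv]
  | succ n ih =>
    intro v hv
    rw [Function.iterate_succ']
    refine (G_mono ih v).trans ?_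
    have hconv : gaussianReal 0 ((n + 1 : ℕ) : NNReal)
        = (gam).conv (gaussianReal 0 (n : NNReal)) := by
      rw [gaussianReal_conv_gaussianReal]
      push_cast; rw [add_comm, zero_add]
    rw [hconv, Measure.conv, Measure.map_apply (by fun_prop) measurableSet_Iic,
      Measure.prod_apply (measurableSet_Iic.preimage (by fun_prop))]
    unfold G
    refine lintegral_mono fun s => ?_
    refine (Set.indicator_le_self' (fun _ _ => zero_le) _).trans_eq ?_
    congr 1
    ext x
    simp [le_sub_iff_add_le, add_comm]

lemma Gn_one_decay : ∃ A : ℝ, 1 ≤ A ∧ ∀ b, 0 ≤ b → ∀ j : ℕ,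
    G^[2 ^ j] (fun _ => 1) b ≤ ENNReal.ofReal (3 * (b + A) * (9/10) ^ j) := by
  obtain ⟨A, hA, h⟩ := exA1
  refine ⟨A, hA, fun b hb j => ?_⟩
  have hone : ∀ n, G^[n] (fun _ => 1) b ≤ 1 := fun n =>
    (Gn_one_le n b hb).trans prob_le_one
  induction j with
  | zero =>
    refine (hone _).trans ?_
    rw [ENNReal.one_le_ofReal]; simp; linarith
  | succ j ih =>
    have hN : 0 < 2 ^ j := by positivity
    rw [pow_succ, mul_two, Function.iterate_add_apply]
    set a : ENNReal := ENNReal.ofReal (1/2)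
    set e : ENNReal := ENNReal.ofReal (1 / √((2 ^ j : ℕ) : ℝ))
    have h1 : ∀ v, 0 ≤ v → G^[2 ^ j] (fun _ => 1) v ≤ a * 1 + e * ENNReal.ofReal (v + A) := by
      intro v hv
      refine (Gn_one_le _ v hv).trans ((gauss_cdf _ hN v hv).trans ?_)
      rw [mul_one, ← ENNReal.ofReal_mul (by positivity)]
      gcongr
      rw [one_div_mul_eq_div]
      gcongr
      linarith
    refine (Gn_mono h1 (2 ^ j) b hb).trans ?_
    have hm : Measurable (fun u : ℝ => ENNReal.ofReal (u + A)) := by fun_prop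
    rw [Gn_add (φ := fun _ => a * 1) (ψ := fun v => e * ENNReal.ofReal (v + A)) (by fun_prop),
      Gn_const_mul (φ := fun _ => 1) (by fun_prop),
      Gn_const_mul (φ := fun v => ENNReal.ofReal (v + A)) hm]
    have h2 := Gn_super h (2 ^ j) b hb
    refine (add_le_add (mul_le_mul_right ih a) (mul_le_mul_right h2 e)).trans ?_
    have hs : (7/10 : ℝ)⁻¹ ^ j * (9/10) ^ j ≥ 1 := by
      rw [← mul_pow]; exact one_le_pow₀ (by norm_num)
    have hsq : 1 / √((2 ^ j : ℕ) : ℝ) ≤ (9/10 : ℝ) ^ j := by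
      rw [div_le_iff₀ (by positivity)]
      push_cast
      have : √((2:ℝ) ^ j) = (√2) ^ j := by
        rw [Real.sqrt_eq_iff_mul_self_eq (by positivity) (by positivity), ← mul_pow]
        simp
      rw [this, ← mul_pow]
      refine one_le_pow₀ ?_
      have : (1.2 : ℝ) ≤ √2 := Real.le_sqrt_of_sq_le (by norm_num)
      linarith
    rw [← ENNReal.ofReal_mul (by positivity), ← ENNReal.ofReal_mul (by positivity),
      ← ENNReal.ofReal_add (by positivity) (by positivity)]
    refine ENNReal.ofReal_le_ofReal ?_
    rw [pow_succ]
    have hp : (0:ℝ) < (9/10) ^ j := by positivity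
    nlinarith [mul_le_mul_of_nonneg_right hsq (show 0 ≤ b + A by linarith)]

lemma pot (θ : ℝ) (hθ : 0 < θ) : ∃ C : ℝ, 0 ≤ C ∧ ∀ b, 0 ≤ b →
    ∑' m : ℕ, ENNReal.ofReal ((21/20 : ℝ) ^ (Nat.log 2 m)) *
      G^[m] (fun u => ENNReal.ofReal (Real.exp (-θ * u))) b ≤ ENNReal.ofReal (C * (b + 1)) := by
  obtain ⟨A, hA, ε, hε, h⟩ := exA2 θ hθ
  obtain ⟨A', hA', h'⟩ := Gn_one_decay
  set φ : ℝ → ENNReal := fun u => ENNReal.ofReal (Real.exp (-θ * u)) with hφ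
  have hφm : Measurable φ := by fun_prop
  have tail : ∀ b, 0 ≤ b → ∀ i : ℕ, ∑' m : ℕ, (if 2 ^ i ≤ m then G^[m] φ b else 0)
      ≤ ENNReal.ofReal (3 * A * A' / ε * (b + 1) * (9/10) ^ i) := by
    intro b hb i
    have h1 := potential (φ := fun u => ENNReal.ofReal ε * φ u) (by fun_prop) (fun u hu => by
      simpa only [hφ, ← ENNReal.ofReal_mul hε.le] using h u hu) (2 ^ i) b hb
    have e1 : ∀ m : ℕ, (if 2 ^ i ≤ m then G^[m] (fun u => ENNReal.ofReal ε * φ u) b else 0)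
        = ENNReal.ofReal ε * (if 2 ^ i ≤ m then G^[m] φ b else 0) := by
      intro m; split_ifs
      · rw [Gn_const_mul hφm]
      · simp
    simp_rw [e1] at h1
    rw [ENNReal.tsum_mul_left] at h1
    have h2 : G^[2 ^ i] (fun u => ENNReal.ofReal (A - Real.exp (-θ * u))) b
        ≤ ENNReal.ofReal A * G^[2 ^ i] (fun _ => 1) b := by
      have := Gn_mono (φ := fun u => ENNReal.ofReal (A - Real.exp (-θ * u)))
        (ψ := fun u => ENNReal.ofReal A * 1) (fun u _ => by
          rw [mul_one]
          exact ENNReal.ofReal_le_ofReal (by linarith [Real.exp_pos (-θ * u)])) (2 ^ i) b hb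
      rwa [Gn_const_mul (φ := fun _ => 1) (by fun_prop)] at this
    have h3 := h1.trans (h2.trans (mul_le_mul_right (h' b hb i) _))
    have h4 : ENNReal.ofReal ε ≠ 0 := by simpa using hε
    rw [mul_comm, ← ENNReal.le_div_iff_mul_le (Or.inl h4) (Or.inl ENNReal.ofReal_ne_top),
      ← ENNReal.ofReal_mul (by linarith), ← ENNReal.ofReal_div_of_pos hε] at h3
    refine h3.trans (ENNReal.ofReal_le_ofReal ?_)
    rw [div_le_iff₀ hε]
    have : 3 * A * A' / ε * (b + 1) * (9 / 10) ^ i * ε = A * (3 * (A' * (b + 1)) * (9/10) ^ i) := by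
      field_simp
    rw [this]
    gcongr
    nlinarith
  set D := 3 * A * A' / ε with hD
  have hD0 : 0 ≤ D := by positivity
  refine ⟨1 + D * 20, by positivity, fun b hb => ?_⟩
  have hpt : ∀ m : ℕ, ENNReal.ofReal ((21/20 : ℝ) ^ (Nat.log 2 m)) * G^[m] φ b
      ≤ (if m = 0 then 1 else 0) +
        ∑' i : ℕ, ENNReal.ofReal ((21/20 : ℝ) ^ i) * (if 2 ^ i ≤ m then G^[m] φ b else 0) := by
    intro m
    by_cases hm : m = 0
    · subst hm
      simp only [Nat.log_zero_right, pow_zero, ENNReal.ofReal_one, one_mul, if_true]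
      refine le_trans ?_ le_self_add
      simp [hφ]; positivity
    · rw [if_neg hm, zero_add]
      refine le_trans ?_ (ENNReal.le_tsum (Nat.log 2 m))
      rw [if_pos (Nat.pow_log_le_self 2 hm)]
  refine (ENNReal.tsum_le_tsum hpt).trans ?_
  rw [ENNReal.tsum_add, ENNReal.tsum_comm, tsum_ite_eq]
  simp_rw [ENNReal.tsum_mul_left]
  have h5 : ∀ i : ℕ, ENNReal.ofReal ((21/20 : ℝ) ^ i) *
      ∑' m : ℕ, (if 2 ^ i ≤ m then G^[m] φ b else 0)
      ≤ ENNReal.ofReal (D * (b + 1)) * ENNReal.ofReal ((189/200 : ℝ)) ^ i := by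
    intro i
    refine (mul_le_mul_right (tail b hb i) _).trans_eq ?_
    rw [← ENNReal.ofReal_pow (by norm_num), ← ENNReal.ofReal_mul (by positivity),
      ← ENNReal.ofReal_mul (by positivity)]
    congr 1
    rw [show (189/200 : ℝ) = 21/20 * (9/10) by norm_num, mul_pow]
    ring
  refine (add_le_add_right (ENNReal.tsum_le_tsum h5) _).trans ?_
  rw [ENNReal.tsum_mul_left, ENNReal.tsum_geometric, ← ENNReal.ofReal_one,
    ← ENNReal.ofReal_sub _ (by norm_num), ← ENNReal.ofReal_inv_of_pos (by norm_num),
    ← ENNReal.ofReal_mul (by positivity), ← ENNReal.ofReal_add (by norm_num) (by positivity)]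
  refine ENNReal.ofReal_le_ofReal ?_
  norm_num
  nlinarith [mul_nonneg hD0 hb]


abbrev EE (d : ℕ) := EuclideanSpace ℝ (Fin d)

/-- discrete-time log-correlated walk -/
structure DW (d : ℕ) {Ω : Type*} [MeasurableSpace Ω] (P : Measure Ω)
    (S : ℕ → EE d → Ω → ℝ) (R C0 : ℝ) : Prop where
  meas : ∀ n x, Measurable (S n x)
  cont : ∀ n ω, Continuous (fun x => S n x ω)
  zero : ∀ x, ∀ᵐ ω ∂P, S 0 x ω = 0
  inc_law : ∀ n x, P.map (fun ω => S (n+1) x ω - S n x ω) = gam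
  inc_indep : ∀ n x, IndepFun (fun ω => S (n+1) x ω - S n x ω)
    (fun ω (j : ℕ) => S (min j n) x ω) P
  pair_law : ∀ (n : ℕ) (x y : EE d), R ≤ Real.exp (n : ℝ) * ‖x - y‖ →
    P.map (fun ω => (S (n+1) x ω - S n x ω, S (n+1) y ω - S n y ω)) = gam.prod gam
  pair_indep : ∀ n x y, IndepFun (fun ω => (S (n+1) x ω - S n x ω, S (n+1) y ω - S n y ω))
    (fun ω => ((fun (j : ℕ) => S (min j n) x ω), (fun (j : ℕ) => S (min j n) y ω))) P
  mgf : ∀ (n : ℕ) (y y' : EE d) (lam : ℝ), 0 ≤ lam →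
    ∫⁻ ω, ENNReal.ofReal (Real.exp (√(2 * d) * S n y ω + lam * (S n y ω - S n y' ω))) ∂P
      ≤ ENNReal.ofReal (Real.exp (d * n + (√(2 * d) * lam + lam ^ 2) *
        (C0 * (Real.exp n * ‖y - y'‖))))

/-- barrier set -/
def Bq (c b : ℝ) (n : ℕ) : Set (ℕ → ℝ) := {q | ∀ j ≤ n, 0 ≤ c * j - q j + b}

lemma Bq_meas (c b : ℝ) (n : ℕ) : MeasurableSet (Bq c b n) := by
  have : Bq c b n = ⋂ j : ℕ, ⋂ _ : j ≤ n, {q : ℕ → ℝ | 0 ≤ c * j - q j + b} := by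
    ext q; simp [Bq]
  rw [this]
  refine MeasurableSet.iInter fun j => MeasurableSet.iInter fun _ => ?_
  exact measurableSet_le (by fun_prop) (by fun_prop)

def wt (c dd b : ℝ) (φ : ℝ → ENNReal) (n : ℕ) (q : ℕ → ℝ) : ENNReal :=
  ENNReal.ofReal (Real.exp (c * q n - dd * n)) *
    (Bq c b n).indicator (fun q => φ (c * n - q n + b)) q

lemma wt_meas (c dd b : ℝ) {φ : ℝ → ENNReal} (hφ : Measurable φ) (n : ℕ) :
    Measurable (wt c dd b φ n) := by
  unfold wt
  refine Measurable.mul (by fun_prop) ?_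
  exact (hφ.comp (by fun_prop)).indicator (Bq_meas c b n)

lemma wt_mono (c dd b : ℝ) {φ ψ : ℝ → ENNReal} (h : ∀ u, 0 ≤ u → φ u ≤ ψ u) (n : ℕ) (q : ℕ → ℝ) :
    wt c dd b φ n q ≤ wt c dd b ψ n q := by
  unfold wt
  refine mul_le_mul_right ?_ _
  by_cases hq : q ∈ Bq c b n
  · rw [Set.indicator_of_mem hq, Set.indicator_of_mem hq]
    exact h _ (hq n le_rfl)
  · rw [Set.indicator_of_notMem hq, Set.indicator_of_notMem hq]

def stp (c dd b : ℝ) (φ : ℝ → ENNReal) (n : ℕ) (q : ℕ → ℝ) (ξ : ℝ) : ENNReal :=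
  ENNReal.ofReal (Real.exp (c * q n - dd * n)) * (Bq c b n).indicator (fun _ => 1) q *
    (ENNReal.ofReal (Real.exp (c * ξ - dd)) *
      (Set.Ici (0:ℝ)).indicator φ (c * n - q n + b - (ξ - c)))

lemma stp_meas (c dd b : ℝ) {φ : ℝ → ENNReal} (hφ : Measurable φ) (n : ℕ) :
    Measurable (fun p : (ℕ → ℝ) × ℝ => stp c dd b φ n p.1 p.2) := by
  unfold stp
  refine Measurable.mul (Measurable.mul (by fun_prop) ?_) (Measurable.mul (by fun_prop) ?_)
  · exact (measurable_const.indicator (Bq_meas c b n)).comp measurable_fst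
  · exact (hφ.indicator measurableSet_Ici).comp (by fun_prop)

lemma wt_succ (c dd b : ℝ) (φ : ℝ → ENNReal) (n : ℕ) (q : ℕ → ℝ) :
    wt c dd b φ (n + 1) q = stp c dd b φ n (fun j => q (min j n)) (q (n + 1) - q n) := by
  have h2 : c * ((n + 1 : ℕ) : ℝ) - q (n + 1) + b = c * n - q n + b - (q (n + 1) - q n - c) := by
    push_cast; ring
  have h3 : Real.exp (c * q (n + 1) - dd * ((n + 1 : ℕ) : ℝ))
      = Real.exp (c * q n - dd * n) * Real.exp (c * (q (n + 1) - q n) - dd) := by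
    rw [← Real.exp_add]; push_cast; ring_nf
  have hB : q ∈ Bq c b (n + 1) ↔ (fun j => q (min j n)) ∈ Bq c b n ∧
      0 ≤ c * n - q n + b - (q (n + 1) - q n - c) := by
    rw [← h2]
    constructor
    · intro h
      refine ⟨fun j hj => ?_, h (n + 1) le_rfl⟩
      simp only [min_eq_left hj]; exact h j (by omega)
    · rintro ⟨h, h'⟩ j hj
      rcases Nat.lt_or_ge j (n + 1) with hj' | hj'
      · have := h j (by omega)
        simpa only [min_eq_left (show j ≤ n by omega)] using this
      · have : j = n + 1 := by omega
        subst this; exact h'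
  unfold wt stp
  simp only [min_self]
  rw [h3, ENNReal.ofReal_mul (Real.exp_pos _).le]
  by_cases hq : (fun j => q (min j n)) ∈ Bq c b n
  · by_cases hx : 0 ≤ c * n - q n + b - (q (n + 1) - q n - c)
    · rw [Set.indicator_of_mem (hB.2 ⟨hq, hx⟩), Set.indicator_of_mem hq,
        Set.indicator_of_mem (s := Set.Ici 0) hx, h2]
      ring
    · rw [Set.indicator_of_notMem (fun h => hx (hB.1 h).2),
        Set.indicator_of_notMem (s := Set.Ici 0) hx]
      simp
  · rw [Set.indicator_of_notMem (fun h => hq (hB.1 h).1), Set.indicator_of_notMem hq]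
    simp

lemma stp_int (c dd b : ℝ) (hc : c ^ 2 = 2 * dd) {φ : ℝ → ENNReal} (hφ : Measurable φ) (n : ℕ)
    (q : ℕ → ℝ) : ∫⁻ ξ, stp c dd b φ n q ξ ∂gam = wt c dd b (G φ) n q := by
  unfold stp
  have hm : Measurable (fun ξ => (Set.Ici (0:ℝ)).indicator φ (c * n - q n + b - (ξ - c))) :=
    (hφ.indicator measurableSet_Ici).comp (by fun_prop)
  rw [lintegral_const_mul _ (by fun_prop), gauss_tilt c dd hc _ hm]
  simp only [add_sub_cancel_right]
  unfold wt
  rw [mul_assoc]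
  congr 1
  by_cases hq : q ∈ Bq c b n
  · simp [hq, G]
  · simp [hq]

lemma lintegral_indep {Ω α β : Type*} [MeasurableSpace Ω] [MeasurableSpace α] [MeasurableSpace β]
    (P : Measure Ω) [IsProbabilityMeasure P] {X : Ω → α} {Y : Ω → β} (hX : Measurable X)
    (hY : Measurable Y) (h : IndepFun X Y P) {F : β → α → ENNReal}
    (hF : Measurable (fun p : β × α => F p.1 p.2)) :
    ∫⁻ ω, F (Y ω) (X ω) ∂P = ∫⁻ ω, ∫⁻ a, F (Y ω) a ∂(P.map X) ∂P := by
  have h1 := (indepFun_iff_map_prod_eq_prod_map_map hY.aemeasurable hX.aemeasurable).1 h.symm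
  have h2 : ∫⁻ ω, F (Y ω) (X ω) ∂P = ∫⁻ p, F p.1 p.2 ∂(P.map (fun ω => (Y ω, X ω))) := by
    rw [lintegral_map hF (hY.prodMk hX)]
  have := Measure.isProbabilityMeasure_map (μ := P) hX.aemeasurable
  rw [h2, h1, lintegral_prod _ hF.aemeasurable, lintegral_map _ hY]
  exact hF.lintegral_prod_right'

section
variable {d : ℕ} {Ω : Type*} [MeasurableSpace Ω] {P : Measure Ω} [IsProbabilityMeasure P]
  {S : ℕ → EE d → Ω → ℝ} {R C0 : ℝ}

lemma csq (d : ℕ) : (√(2 * (d:ℝ))) ^ 2 = 2 * d := Real.sq_sqrt (by positivity)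

lemma DW.path_meas (h : DW d P S R C0) (x : EE d) : Measurable (fun ω (j : ℕ) => S j x ω) :=
  measurable_pi_lambda _ fun j => h.meas j x

lemma DW.past_meas (h : DW d P S R C0) (x : EE d) (n : ℕ) :
    Measurable (fun ω (j : ℕ) => S (min j n) x ω) :=
  measurable_pi_lambda _ fun _ => h.meas _ x

/-- integral against one more step -/
lemma DW.step_gen (h : DW d P S R C0) (x : EE d) (n : ℕ) {F : (ℕ → ℝ) → ℝ → ENNReal}
    (hF : Measurable (fun p : (ℕ → ℝ) × ℝ => F p.1 p.2)) :
    ∫⁻ ω, F (fun j => S (min j n) x ω) (S (n+1) x ω - S n x ω) ∂P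
      = ∫⁻ ω, ∫⁻ ξ, F (fun j => S (min j n) x ω) ξ ∂gam ∂P := by
  rw [← h.inc_law n x]
  exact lintegral_indep P ((h.meas _ x).sub (h.meas _ x)) (h.past_meas x n) (h.inc_indep n x) hF

lemma wt_past (c dd b : ℝ) (φ : ℝ → ENNReal) (n : ℕ) (q : ℕ → ℝ) :
    wt c dd b φ n (fun j => q (min j n)) = wt c dd b φ n q := by
  unfold wt
  simp only [min_self]
  congr 1
  have : (fun j => q (min j n)) ∈ Bq c b n ↔ q ∈ Bq c b n := by
    unfold Bq
    refine forall₂_congr fun j hj => ?_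
    simp [hj]
  by_cases hq : q ∈ Bq c b n
  · simp [hq, this.2 hq]
  · rw [Set.indicator_of_notMem hq, Set.indicator_of_notMem (fun hh => hq (this.1 hh))]

lemma DW.L_succ (h : DW d P S R C0) (x : EE d) (b : ℝ) (n : ℕ) {φ : ℝ → ENNReal}
    (hφ : Measurable φ) :
    ∫⁻ ω, wt √(2 * d) d b φ (n+1) (fun j => S j x ω) ∂P
      = ∫⁻ ω, wt √(2 * d) d b (G φ) n (fun j => S j x ω) ∂P := by
  simp_rw [wt_succ]
  rw [h.step_gen x n (stp_meas _ _ _ hφ n)]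
  refine lintegral_congr fun ω => ?_
  rw [stp_int _ _ _ (csq d) hφ]
  exact wt_past _ _ _ _ n (fun j => S j x ω)

lemma DW.L_eq (h : DW d P S R C0) (x : EE d) (b : ℝ) (hb : 0 ≤ b) (n : ℕ) {φ : ℝ → ENNReal}
    (hφ : Measurable φ) :
    ∫⁻ ω, wt √(2 * d) d b φ n (fun j => S j x ω) ∂P = G^[n] φ b := by
  induction n generalizing φ with
  | zero =>
    have : ∀ᵐ ω ∂P, wt √(2 * d) d b φ 0 (fun j => S j x ω) = φ b := by
      filter_upwards [h.zero x] with ω hω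
      have : (fun j => S j x ω) ∈ Bq √(2 * d) b 0 := by
        intro j hj
        have : j = 0 := by omega
        subst this; simp [hω, hb]
      unfold wt
      rw [Set.indicator_of_mem this]
      simp [hω]
    rw [lintegral_congr_ae this]; simp
  | succ n ih => rw [h.L_succ x b n hφ, ih (G_meas hφ), Function.iterate_succ]; rfl

set_option maxHeartbeats 2000000 in
lemma DW.pair_step (h : DW d P S R C0) (x y : EE d) (b : ℝ) (n : ℕ) {φ : ℝ → ENNReal}
    (hφ : Measurable φ) (hR : R ≤ Real.exp n * ‖x - y‖) :
    ∫⁻ ω, wt √(2 * d) d b φ (n+1) (fun j => S j x ω) * wt √(2 * d) d b φ (n+1) (fun j => S j y ω) ∂P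
      = ∫⁻ ω, wt √(2 * d) d b (G φ) n (fun j => S j x ω)
          * wt √(2 * d) d b (G φ) n (fun j => S j y ω) ∂P := by
  simp_rw [wt_succ]
  have hm := stp_meas √(2 * d) d b hφ n
  have hF : Measurable (fun p : ((ℕ → ℝ) × (ℕ → ℝ)) × (ℝ × ℝ) =>
      stp √(2 * d) d b φ n p.1.1 p.2.1 * stp √(2 * d) d b φ n p.1.2 p.2.2) :=
    (hm.comp (f := fun p : ((ℕ → ℝ) × (ℕ → ℝ)) × (ℝ × ℝ) => (p.1.1, p.2.1)) (by fun_prop)).mul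
    (hm.comp (f := fun p : ((ℕ → ℝ) × (ℕ → ℝ)) × (ℝ × ℝ) => (p.1.2, p.2.2)) (by fun_prop))
  have m1 : Measurable (fun ω => (S (n+1) x ω - S n x ω, S (n+1) y ω - S n y ω)) :=
    ((h.meas (n+1) x).sub (h.meas n x)).prodMk ((h.meas (n+1) y).sub (h.meas n y))
  have m2 : Measurable (fun ω => ((fun (j : ℕ) => S (min j n) x ω),
      (fun (j : ℕ) => S (min j n) y ω))) := (h.past_meas x n).prodMk (h.past_meas y n)
  have key := lintegral_indep P m1 m2 (h.pair_indep n x y)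
    (F := fun q ξ => stp √(2 * d) d b φ n q.1 ξ.1 * stp √(2 * d) d b φ n q.2 ξ.2) hF
  rw [h.pair_law n x y hR] at key
  refine Eq.trans ?_ (key.trans ?_)
  · rfl
  refine lintegral_congr fun ω => ?_
  have hs : ∀ q, Measurable (stp √(2 * d) d b φ n q) := fun q => hm.comp (measurable_prodMk_left (x := q))
  rw [lintegral_prod_mul (hs _).aemeasurable (hs _).aemeasurable]
  rw [stp_int _ _ _ (csq d) hφ, stp_int _ _ _ (csq d) hφ]
  congr 1
  · exact wt_past _ _ _ _ n (fun j => S j x ω)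
  · exact wt_past _ _ _ _ n (fun j => S j y ω)

lemma DW.pair_dec (h : DW d P S R C0) (x y : EE d) (b : ℝ) {φ : ℝ → ENNReal}
    (hφ : Measurable φ) (hG : ∀ u, 0 ≤ u → G φ u ≤ φ u) (m : ℕ)
    (hR : R ≤ Real.exp m * ‖x - y‖) (k : ℕ) :
    ∫⁻ ω, wt √(2 * d) d b φ (m+k) (fun j => S j x ω) * wt √(2 * d) d b φ (m+k) (fun j => S j y ω) ∂P
      ≤ ∫⁻ ω, wt √(2 * d) d b φ m (fun j => S j x ω) * wt √(2 * d) d b φ m (fun j => S j y ω) ∂P := by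
  induction k with
  | zero => rfl
  | succ k ih =>
    refine le_trans ?_ ih
    rw [← add_assoc, h.pair_step x y b (m + k) hφ (hR.trans (by gcongr; simp))]
    refine lintegral_mono fun ω => ?_
    exact mul_le_mul' (wt_mono _ _ _ hG _ _) (wt_mono _ _ _ hG _ _)

lemma wt_sq (hd : 1 ≤ d) (A : ℝ) (hA : 1 ≤ A) (b : ℝ) : ∃ K : ℝ, 0 ≤ K ∧ ∀ (m : ℕ) (q : ℕ → ℝ),
    (wt √(2 * d) d b (fun u => ENNReal.ofReal (u + A)) m q) ^ 2 ≤ ENNReal.ofReal (K * Real.exp (d * m)) *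
      wt √(2 * d) d b (fun u => ENNReal.ofReal (Real.exp (-(√(2 * d) / 2) * u))) m q := by
  set c := √(2 * (d:ℝ)) with hc
  have hd' : (1:ℝ) ≤ d := by exact_mod_cast hd
  have hc0 : 0 < c := Real.sqrt_pos.2 (by linarith)
  have hc2 : c ^ 2 = 2 * d := csq d
  -- polynomial against exponential
  have hpoly : ∃ K1 : ℝ, 0 ≤ K1 ∧ ∀ v, 0 ≤ v → (v + A) ^ 2 ≤ K1 * Real.exp (c / 2 * v) := by
    refine ⟨(4 / c + A) ^ 2, by positivity, fun v hv => ?_⟩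
    have h1 : c / 4 * v + 1 ≤ Real.exp (c / 4 * v) := Real.add_one_le_exp _
    have h2 : v + A ≤ (4 / c + A) * Real.exp (c / 4 * v) := by
      have h3 : (4 / c) * (c / 4 * v) ≤ (4 / c) * Real.exp (c / 4 * v) := by gcongr; linarith
      have h4 : (4 / c) * (c / 4 * v) = v := by field_simp
      have h5 : A * 1 ≤ A * Real.exp (c / 4 * v) := by
        gcongr; exact Real.one_le_exp (by positivity)
      nlinarith
    calc (v + A) ^ 2 ≤ ((4 / c + A) * Real.exp (c / 4 * v)) ^ 2 := by gcongr
      _ = _ := by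
        rw [mul_pow, sq (Real.exp _), ← Real.exp_add]; ring_nf
  obtain ⟨K1, hK1, hp⟩ := hpoly
  refine ⟨K1 * Real.exp (c * b), by positivity, fun m q => ?_⟩
  unfold wt
  by_cases hq : q ∈ Bq c b m
  · rw [Set.indicator_of_mem hq, Set.indicator_of_mem hq]
    have hv : 0 ≤ c * m - q m + b := hq m le_rfl
    rw [← ENNReal.ofReal_mul (by positivity), ← ENNReal.ofReal_mul (by positivity),
      ← ENNReal.ofReal_mul (by positivity), ← ENNReal.ofReal_pow (by positivity)]
    refine ENNReal.ofReal_le_ofReal ?_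
    set v := c * m - q m + b with hvd
    have e1 : c * q m - d * m = -c * v + c * b + d * m := by
      rw [hvd]; linear_combination (m:ℝ) * hc2
    have h1 := hp v hv
    calc (Real.exp (c * q m - d * m) * (v + A)) ^ 2
        = Real.exp (c * q m - d * m) * Real.exp (c * q m - d * m) * (v + A) ^ 2 := by ring
      _ ≤ Real.exp (c * q m - d * m) * Real.exp (c * q m - d * m) * (K1 * Real.exp (c / 2 * v)) := by
          gcongr
      _ = _ := by
          nth_rewrite 2 [e1]
          rw [show -c * v + c * b + d * m = (-(c/2) * v) + (-(c/2 * v)) + c * b + d * m by ring,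
            Real.exp_add, Real.exp_add, Real.exp_add, Real.exp_neg (c / 2 * v)]
          have := Real.exp_pos (c / 2 * v)
          field_simp
  · simp [hq]

lemma DW.pair_bound (h : DW d P S R C0) (hd : 1 ≤ d) (A : ℝ) (hA : 1 ≤ A)
    (hG : ∀ v, 0 ≤ v → G (fun u => ENNReal.ofReal (u + A)) v ≤ ENNReal.ofReal (v + A))
    (b : ℝ) (hb : 0 ≤ b) : ∃ K : ℝ, 0 ≤ K ∧ ∀ (x y : EE d) (N m0 : ℕ),
    Real.exp m0 * ‖x - y‖ < R → m0 ≤ N → ∃ m, m0 ≤ m ∧ ‖x - y‖ ≤ R * Real.exp (1 - m) ∧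
    ∫⁻ ω, wt √(2 * d) d b (fun u => ENNReal.ofReal (u + A)) N (fun j => S j x ω) *
      wt √(2 * d) d b (fun u => ENNReal.ofReal (u + A)) N (fun j => S j y ω) ∂P
      ≤ ENNReal.ofReal (K * Real.exp (d * m)) *
        G^[m] (fun u => ENNReal.ofReal (Real.exp (-(√(2 * d) / 2) * u))) b := by
  obtain ⟨K, hK, hsq⟩ := wt_sq (d := d) hd A hA b
  refine ⟨K, hK, fun x y N m0 hxy hN => ?_⟩
  set H : ℝ → ENNReal := fun u => ENNReal.ofReal (u + A) with hH
  have hHm : Measurable H := by fun_prop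
  set θf : ℝ → ENNReal := fun u => ENNReal.ofReal (Real.exp (-(√(2 * d) / 2) * u)) with hθ
  have hθm : Measurable θf := by fun_prop
  have diag : ∀ m, ∫⁻ ω, wt √(2 * d) d b H m (fun j => S j x ω) *
      wt √(2 * d) d b H m (fun j => S j y ω) ∂P ≤ ENNReal.ofReal (K * Real.exp (d * m)) * G^[m] θf b := by
    intro m
    have hx : ∀ x, Measurable fun ω => wt √(2 * d) d b θf m (fun j => S j x ω) := fun x =>
      (wt_meas _ _ _ hθm m).comp (h.path_meas x)
    have one : ∀ x, ∫⁻ ω, (wt √(2 * d) d b H m (fun j => S j x ω)) ^ 2 ∂P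
        ≤ ENNReal.ofReal (K * Real.exp (d * m)) * G^[m] θf b := by
      intro x
      refine (lintegral_mono fun ω => hsq m _).trans_eq ?_
      rw [lintegral_const_mul _ (hx x), h.L_eq x b hb m hθm]
    have amgm : ∀ u v : ENNReal, u * v ≤ (1/2) * (u ^ 2 + v ^ 2) := by
      intro u v
      rcases eq_or_ne u ⊤ with rfl | hu
      · simp
      rcases eq_or_ne v ⊤ with rfl | hv
      · simp
      lift u to NNReal using hu
      lift v to NNReal using hv
      have : (u * v : NNReal) ≤ (1/2) * (u ^ 2 + v ^ 2) := by
        rw [← NNReal.coe_le_coe]; push_cast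
        nlinarith [sq_nonneg ((u:ℝ) - v)]
      have h2 : ((1/2 : NNReal) : ENNReal) = 1/2 := by
        rw [ENNReal.coe_div (by norm_num)]; simp
      rw [← h2]
      exact_mod_cast this
    refine (lintegral_mono fun ω => amgm _ _).trans ?_
    have hm2 : Measurable fun ω => (wt √(2 * d) d b H m (fun j => S j x ω)) ^ 2 :=
      ((wt_meas _ _ _ hHm m).comp (h.path_meas x)).pow_const 2
    rw [lintegral_const_mul' _ _ (by simp), lintegral_add_left hm2]
    refine (mul_le_mul_right (add_le_add (one x) (one y)) _).trans_eq ?_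
    rw [← two_mul, ← mul_assoc, one_div, ENNReal.inv_mul_cancel (by simp) (by simp), one_mul]
  have hexp : ∀ m : ℕ, Real.exp (1 - m) = Real.exp 1 / Real.exp m := fun m => Real.exp_sub _ _
  rcases lt_or_ge (Real.exp N * ‖x - y‖) R with hNR | hNR
  · refine ⟨N, hN, ?_, diag N⟩
    rw [hexp, mul_div_assoc', le_div_iff₀ (Real.exp_pos _)]
    have h0 : 0 ≤ Real.exp N * ‖x - y‖ := by positivity
    have : (1:ℝ) ≤ Real.exp 1 := Real.one_le_exp (by norm_num)
    nlinarith
  · classical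
    have hex : ∃ m : ℕ, R ≤ Real.exp m * ‖x - y‖ := ⟨N, hNR⟩
    set m := Nat.find hex with hm
    have hm1 : R ≤ Real.exp m * ‖x - y‖ := Nat.find_spec hex
    have hmN : m ≤ N := Nat.find_min' hex hNR
    have hm0 : m0 < m := by
      by_contra hcon
      have : Real.exp m ≤ Real.exp m0 := Real.exp_le_exp.2 (by exact_mod_cast not_lt.1 hcon)
      have := mul_le_mul_of_nonneg_right this (norm_nonneg (x - y))
      linarith
    refine ⟨m, hm0.le, ?_, ?_⟩
    · obtain ⟨m', hm'⟩ : ∃ m', m = m' + 1 := ⟨m - 1, by omega⟩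
      have h1 : ¬ (R ≤ Real.exp m' * ‖x - y‖) := Nat.find_min hex (by omega)
      rw [hm']
      have : Real.exp (1 - ((m' + 1 : ℕ) : ℝ)) = 1 / Real.exp m' := by
        rw [one_div, ← Real.exp_neg]; push_cast; ring_nf
      rw [this, mul_one_div, le_div_iff₀ (Real.exp_pos _)]
      linarith
    · obtain ⟨k, rfl⟩ := Nat.exists_eq_add_of_le hmN
      exact (h.pair_dec x y b hHm hG m hm1 k).trans (diag m)

end


section
variable {d : ℕ} {Ω : Type*} [MeasurableSpace Ω] {P : Measure Ω} [IsProbabilityMeasure P]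
  {S : ℕ → EE d → Ω → ℝ} {R C0 : ℝ}

lemma DW.joint_meas (h : DW d P S R C0) {c dd b : ℝ} {φ : ℝ → ENNReal} (hφ : Measurable φ) (n : ℕ) :
    Measurable (fun p : EE d × Ω => wt c dd b φ n (fun j => S j p.1 p.2)) := by
  refine (wt_meas c dd b hφ n).comp (measurable_pi_lambda _ fun j => ?_)
  exact measurable_uncurry_of_continuous_of_measurable (h.cont j) (h.meas j)

def II (S : ℕ → EE d → Ω → ℝ) (R A b J : ℝ) (N m0 : ℕ) (ω : Ω) : ENNReal :=
  ∫⁻ p : EE d × EE d, ({p : EE d × EE d | Real.exp m0 * ‖p.1 - p.2‖ < R}).indicator (fun p =>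
    wt √(2 * d) d b (fun u => ENNReal.ofReal (u + A)) N (fun j => S j p.1 ω) *
    wt √(2 * d) d b (fun u => ENNReal.ofReal (u + A)) N (fun j => S j p.2 ω)) p
    ∂((volume.restrict (Metric.ball 0 J)).prod volume)

lemma measT (m0 : ℕ) : MeasurableSet {p : EE d × EE d | Real.exp m0 * ‖p.1 - p.2‖ < R} :=
  measurableSet_lt (by fun_prop) (by fun_prop)

lemma DW.II_meas2 (h : DW d P S R C0) (A b : ℝ) (N m0 : ℕ) :
    Measurable (fun z : (EE d × EE d) × Ω =>
    ({p : EE d × EE d | Real.exp m0 * ‖p.1 - p.2‖ < R}).indicator (fun p =>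
    wt √(2 * d) d b (fun u => ENNReal.ofReal (u + A)) N (fun j => S j p.1 z.2) *
    wt √(2 * d) d b (fun u => ENNReal.ofReal (u + A)) N (fun j => S j p.2 z.2)) z.1) := by
  have hH : Measurable (fun u : ℝ => ENNReal.ofReal (u + A)) := by fun_prop
  have h0 := h.joint_meas (c := √(2 * d)) (dd := d) (b := b) hH N
  have h1 : Measurable (fun z : (EE d × EE d) × Ω => wt √(2 * d) d b (fun u => ENNReal.ofReal (u + A)) N (fun j => S j z.1.1 z.2) *
    wt √(2 * d) d b (fun u => ENNReal.ofReal (u + A)) N (fun j => S j z.1.2 z.2)) :=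
    (h0.comp (g := _) (f := fun z : (EE d × EE d) × Ω => (z.1.1, z.2)) (by fun_prop)).mul
    (h0.comp (g := _) (f := fun z : (EE d × EE d) × Ω => (z.1.2, z.2)) (by fun_prop))
  have h2 := h1.indicator ((measT (d := d) (R := R) m0).preimage (measurable_fst (β := Ω)))
  exact h2

lemma DW.II_meas (h : DW d P S R C0) (A b J : ℝ) (N m0 : ℕ) :
    Measurable (II S R A b J N m0) := by
  unfold II
  exact (h.II_meas2 A b N m0).lintegral_prod_left'

lemma DW.II_exp (h : DW d P S R C0) (A b J : ℝ) (N m0 : ℕ) :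
    ∫⁻ ω, II S R A b J N m0 ω ∂P = ∫⁻ p : EE d × EE d,
     ({p : EE d × EE d | Real.exp m0 * ‖p.1 - p.2‖ < R}).indicator (fun p => ∫⁻ ω,
    wt √(2 * d) d b (fun u => ENNReal.ofReal (u + A)) N (fun j => S j p.1 ω) *
    wt √(2 * d) d b (fun u => ENNReal.ofReal (u + A)) N (fun j => S j p.2 ω) ∂P) p
    ∂((volume.restrict (Metric.ball 0 J)).prod volume) := by
  unfold II
  rw [lintegral_lintegral_swap]
  · refine lintegral_congr fun p => ?_
    by_cases hp : p ∈ {p : EE d × EE d | Real.exp m0 * ‖p.1 - p.2‖ < R}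
    · simp only [Set.indicator_of_mem hp]
    · simp only [Set.indicator_of_notMem hp, lintegral_zero]
  · have := (h.II_meas2 A b N m0).comp (measurable_swap (α := Ω) (β := EE d × EE d))
    exact this.aemeasurable

lemma DW.II_bound (h : DW d P S R C0) (hd : 1 ≤ d) (hR : 0 < R) (A : ℝ) (hA : 1 ≤ A)
    (hG : ∀ v, 0 ≤ v → G (fun u => ENNReal.ofReal (u + A)) v ≤ ENNReal.ofReal (v + A))
    (b : ℝ) (hb : 0 ≤ b) (J : ℝ) : ∃ K : ENNReal, K ≠ ⊤ ∧ ∀ (N m0 : ℕ), m0 ≤ N →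
    ∫⁻ ω, II S R A b J N m0 ω ∂P ≤ K * ∑' i : ℕ,
      G^[i + m0] (fun u => ENNReal.ofReal (Real.exp (-(√(2 * d) / 2) * u))) b := by
  obtain ⟨K, hK, hpb⟩ := h.pair_bound hd A hA hG b hb
  set θf : ℝ → ENNReal := fun u => ENNReal.ofReal (Real.exp (-(√(2 * d) / 2) * u)) with hθ
  set K2 : ENNReal := ENNReal.ofReal (K * (R * Real.exp 1) ^ d) * volume (Metric.ball (0 : EE d) 1) *
    volume (Metric.ball (0 : EE d) J) with hK2
  refine ⟨K2, ?_, fun N m0 hN => ?_⟩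
  · refine ENNReal.mul_ne_top (ENNReal.mul_ne_top ENNReal.ofReal_ne_top ?_) ?_
    · exact measure_ball_lt_top.ne
    · exact measure_ball_lt_top.ne
  rw [h.II_exp]
  have hms : ∀ i : ℕ, MeasurableSet {p : EE d × EE d | ‖p.1 - p.2‖ ≤ R * Real.exp (1 - (i + m0 : ℕ))} :=
    fun i => measurableSet_le (by fun_prop) (by fun_prop)
  have hle : ∀ p : EE d × EE d, ({p : EE d × EE d | Real.exp m0 * ‖p.1 - p.2‖ < R}).indicator (fun p => ∫⁻ ω,
    wt √(2 * d) d b (fun u => ENNReal.ofReal (u + A)) N (fun j => S j p.1 ω) *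
    wt √(2 * d) d b (fun u => ENNReal.ofReal (u + A)) N (fun j => S j p.2 ω) ∂P) p
    ≤ ∑' i : ℕ, (ENNReal.ofReal (K * Real.exp (d * (i + m0 : ℕ))) * G^[i + m0] θf b) * 
      ({p : EE d × EE d | ‖p.1 - p.2‖ ≤ R * Real.exp (1 - (i + m0 : ℕ))}).indicator 1 p := by
    intro p
    by_cases hp : p ∈ {p : EE d × EE d | Real.exp m0 * ‖p.1 - p.2‖ < R}
    · rw [Set.indicator_of_mem hp]
      obtain ⟨m, hm, hm1, hm2⟩ := hpb p.1 p.2 N m0 hp hN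
      obtain ⟨i, rfl⟩ := Nat.exists_eq_add_of_le' hm
      refine hm2.trans ?_
      refine le_trans ?_ (ENNReal.le_tsum i)
      rw [Set.indicator_of_mem (show p ∈ {p : EE d × EE d | ‖p.1 - p.2‖ ≤ R * Real.exp (1 - (i + m0 : ℕ))} from hm1)]
      simp
    · rw [Set.indicator_of_notMem hp]; simp
  refine (lintegral_mono hle).trans ?_
  rw [lintegral_tsum (fun i => ((measurable_one.indicator (hms i)).const_mul _).aemeasurable),
    ← ENNReal.tsum_mul_left]
  refine ENNReal.tsum_le_tsum fun i => ?_
  rw [lintegral_const_mul _ (measurable_one.indicator (hms i)), lintegral_indicator_one (hms i),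
    Measure.prod_apply (hms i)]
  have hsec : ∀ x : EE d, volume (Prod.mk x ⁻¹' {p : EE d × EE d | ‖p.1 - p.2‖ ≤ R * Real.exp (1 - (i + m0 : ℕ))})
      = ENNReal.ofReal ((R * Real.exp (1 - (i + m0 : ℕ))) ^ d) * volume (Metric.ball (0 : EE d) 1) := by
    intro x
    have : Prod.mk x ⁻¹' {p : EE d × EE d | ‖p.1 - p.2‖ ≤ R * Real.exp (1 - (i + m0 : ℕ))}
        = Metric.closedBall x (R * Real.exp (1 - (i + m0 : ℕ))) := by
      ext y; simp [dist_eq_norm, norm_sub_rev]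
    rw [this, Measure.addHaar_closedBall _ _ (by positivity)]
    simp
  simp_rw [hsec]
  rw [lintegral_const, Measure.restrict_apply MeasurableSet.univ, Set.univ_inter]
  have he : K * Real.exp (d * (i + m0 : ℕ)) * (R * Real.exp (1 - (i + m0 : ℕ))) ^ d = K * (R * Real.exp 1) ^ d := by
    rw [Real.exp_sub, mul_pow, mul_pow, div_pow, ← Real.exp_nat_mul (((i + m0 : ℕ) : ℝ)) d]
    field_simp
  rw [hK2, ← he, ENNReal.ofReal_mul (p := K * Real.exp (d * (i + m0 : ℕ))) (by positivity)]
  apply le_of_eq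
  generalize G^[i + m0] θf b = z1
  generalize ENNReal.ofReal (K * Real.exp (d * (i + m0 : ℕ))) = z2
  generalize ENNReal.ofReal ((R * Real.exp (1 - (i + m0 : ℕ))) ^ d) = z3
  ring

lemma DW.second (h : DW d P S R C0) (hd : 1 ≤ d) (hR : 0 < R) (A : ℝ) (hA : 1 ≤ A)
    (hG : ∀ v, 0 ≤ v → G (fun u => ENNReal.ofReal (u + A)) v ≤ ENNReal.ofReal (v + A))
    (b : ℝ) (hb : 0 ≤ b) (J : ℝ) :
    ∀ᵐ ω ∂P, ⨅ m0 : ℕ, liminf (fun N => II S R A b J N m0 ω) atTop = 0 := by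
  obtain ⟨K, hK, hbd⟩ := h.II_bound hd hR A hA hG b hb J
  set q : ℕ → ENNReal := fun i => 
      G^[i] (fun u => ENNReal.ofReal (Real.exp (-(√(2 * d) / 2) * u))) b with hq
  have hd' : (1:ℝ) ≤ d := by exact_mod_cast hd
  obtain ⟨C, hC, hp⟩ := pot (√(2 * d) / 2) (by positivity)
  have hsum : ∑' i, q i ≠ ⊤ := by
    refine ne_top_of_le_ne_top ?_ ((ENNReal.tsum_le_tsum fun i => ?_).trans (hp b hb))
    · exact ENNReal.ofReal_ne_top
    · refine le_mul_of_one_le_left zero_le ?_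
      rw [ENNReal.one_le_ofReal]
      exact one_le_pow₀ (by norm_num)
  have htail := ENNReal.tendsto_sum_nat_add q hsum
  have hKtail : Tendsto (fun m0 => K * ∑' i, q (i + m0)) atTop (nhds 0) := by
    simpa using ENNReal.Tendsto.const_mul htail (Or.inr hK)
  have hm : ∀ m0, Measurable (fun ω => liminf (fun N => II S R A b J N m0 ω) atTop) := fun m0 =>
    Measurable.liminf fun N => h.II_meas A b J N m0
  have hE : ∀ m0, ∫⁻ ω, liminf (fun N => II S R A b J N m0 ω) atTop ∂P ≤ K * ∑' i, q (i + m0) := by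
    intro m0
    refine (lintegral_liminf_le fun N => h.II_meas A b J N m0).trans ?_
    refine liminf_le_of_le (by isBoundedDefault) fun a ha => ?_
    obtain ⟨N, hN⟩ := (ha.and (eventually_ge_atTop m0)).exists
    exact hN.1.trans (hbd N m0 hN.2)
  have hz : ∫⁻ ω, ⨅ m0 : ℕ, liminf (fun N => II S R A b J N m0 ω) atTop ∂P = 0 := by
    refine le_antisymm (ge_of_tendsto' hKtail fun m0 => ?_) zero_le
    exact (lintegral_mono fun ω => iInf_le _ m0).trans (hE m0)
  exact (lintegral_eq_zero_iff (Measurable.iInf hm)).1 hz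

end


section
variable {d : ℕ} {Ω : Type*} [MeasurableSpace Ω] {P : Measure Ω} [IsProbabilityMeasure P]
  {S : ℕ → EE d → Ω → ℝ} {R C0 : ℝ}

lemma DW.chain_prob (h : DW d P S R C0) (n : ℕ) (y y' : EE d) (lam : ℝ) (hl : 0 ≤ lam) (u δ : ℝ) :
    P {ω | u ≤ S n y ω ∧ δ ≤ S n y ω - S n y' ω} ≤
      ENNReal.ofReal (Real.exp (-(√(2 * d) * u) - lam * δ)) *
       ENNReal.ofReal (Real.exp (d * n + (√(2 * d) * lam + lam ^ 2) *
        (C0 * (Real.exp n * ‖y - y'‖)))) := by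
  refine le_trans ?_ (mul_le_mul_right (h.mgf n y y' lam hl) _)
  have hm : Measurable fun ω => ENNReal.ofReal (Real.exp (√(2 * d) * S n y ω + lam * (S n y ω - S n y' ω))) := by
    have := h.meas n y
    have := h.meas n y'
    fun_prop
  rw [← lintegral_const_mul _ hm]
  have hs : MeasurableSet {ω | u ≤ S n y ω ∧ δ ≤ S n y ω - S n y' ω} :=
    (measurableSet_le measurable_const (h.meas n y)).inter
      (measurableSet_le measurable_const ((h.meas n y).sub (h.meas n y')))
  rw [← lintegral_indicator_one hs]
  refine lintegral_mono fun ω => ?_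
  by_cases hω : ω ∈ {ω | u ≤ S n y ω ∧ δ ≤ S n y ω - S n y' ω}
  · rw [Set.indicator_of_mem hω]
    rw [← ENNReal.ofReal_mul (by positivity), ← Real.exp_add]
    simp only [Pi.one_apply, ENNReal.one_le_ofReal]
    refine Real.one_le_exp ?_
    have h1 := mul_le_mul_of_nonneg_left hω.1 (Real.sqrt_nonneg (2 * (d:ℝ)))
    have h2 := mul_le_mul_of_nonneg_left hω.2 hl
    linarith
  · rw [Set.indicator_of_notMem hω]; exact zero_le

lemma gauss_tail (v : ℝ) : gam {s | v - 1 ≤ s} ≤ ENNReal.ofReal (Real.exp (3/2)) * ENNReal.ofReal (Real.exp (-1 * v)) := by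
  have hs : MeasurableSet {s : ℝ | v - 1 ≤ s} := measurableSet_Ici
  rw [← lintegral_indicator_one hs]
  have h1 : ∀ s : ℝ, ({s : ℝ | v - 1 ≤ s}).indicator (1 : ℝ → ENNReal) s ≤ ENNReal.ofReal (Real.exp (1 - v) * Real.exp (1 * s)) := by
    intro s
    by_cases h : s ∈ {s : ℝ | v - 1 ≤ s}
    · rw [Set.indicator_of_mem h, ← Real.exp_add]
      simp only [Pi.one_apply, ENNReal.one_le_ofReal]
      refine Real.one_le_exp ?_
      have : v - 1 ≤ s := h
      linarith
    · rw [Set.indicator_of_notMem h]; exact zero_le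
  refine (lintegral_mono h1).trans ?_
  rw [← ofReal_integral_eq_lintegral_ofReal ((integrable_exp_gam 1).const_mul _)
    (Eventually.of_forall fun s => by positivity), integral_const_mul, integral_exp_gam,
    ← ENNReal.ofReal_mul (by positivity), ← Real.exp_add, ← Real.exp_add]
  apply le_of_eq; congr 2; ring

lemma wt_const_mul (c dd b : ℝ) (a : ENNReal) (φ : ℝ → ENNReal) (n : ℕ) (q : ℕ → ℝ) :
    wt c dd b (fun u => a * φ u) n q = a * wt c dd b φ n q := by
  unfold wt
  by_cases hq : q ∈ Bq c b n
  · rw [Set.indicator_of_mem hq, Set.indicator_of_mem hq]; ring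
  · rw [Set.indicator_of_notMem hq, Set.indicator_of_notMem hq]; simp

set_option maxHeartbeats 2000000 in
lemma DW.first_prob (h : DW d P S R C0) (m : ℕ) (y : EE d) (β : ℝ) (hβ : 0 ≤ β) :
    P {ω | √(2 * d) * (m + 1 : ℕ) + β ≤ S (m + 1) y ω ∧
      ∀ j ≤ m, S j y ω ≤ √(2 * d) * j + β + 1} ≤
    ENNReal.ofReal (Real.exp (3/2) * Real.exp (- (d * (m + 1 : ℕ)) - √(2 * d) * β)) *
      G^[m] (fun u => ENNReal.ofReal (Real.exp (-1 * u))) (β + 1) := by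
  set c := √(2 * (d:ℝ)) with hc
  have hc2 : c ^ 2 = 2 * d := csq d
  have hφm : Measurable (fun u : ℝ => ENNReal.ofReal (Real.exp (-1 * u))) := by fun_prop
  have hL := h.L_eq y (β + 1) (by linarith) m hφm
  set F : (ℕ → ℝ) → ℝ → ENNReal := fun q ξ =>
    ENNReal.ofReal (Real.exp (c * q m - d * m)) * (Bq c (β + 1) m).indicator (fun _ => 1) q *
    (ENNReal.ofReal (Real.exp (c * ξ - d)) *
      ({s : ℝ | 0 ≤ s}).indicator 1 (q m + ξ - (c * (m + 1 : ℕ) + β))) with hF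
  have hFm : Measurable (fun p : (ℕ → ℝ) × ℝ => F p.1 p.2) := by
    refine Measurable.mul (Measurable.mul (by fun_prop) ?_) (Measurable.mul (by fun_prop) ?_)
    · exact (measurable_const.indicator (Bq_meas c _ m)).comp measurable_fst
    · exact (measurable_one.indicator (measurableSet_Ici (a := (0:ℝ)))).comp (by fun_prop)
  have hintgb : ∀ q, ∫⁻ ξ, F q ξ ∂gam ≤ ENNReal.ofReal (Real.exp (3/2)) *
      wt c d (β + 1) (fun u => ENNReal.ofReal (Real.exp (-1 * u))) m q := by
    intro q
    have hm' : Measurable (fun ξ : ℝ => ({s : ℝ | 0 ≤ s}).indicator (1 : ℝ → ENNReal) (q m + ξ - (c * (m + 1 : ℕ) + β))) :=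
      (measurable_one.indicator (measurableSet_Ici (a := (0:ℝ)))).comp (by fun_prop)
    simp only [hF]
    rw [lintegral_const_mul _ (by fun_prop), gauss_tilt c d hc2 _ hm', ← wt_const_mul]
    unfold wt
    rw [mul_assoc]
    refine mul_le_mul_right ?_ _
    by_cases hq : q ∈ Bq c (β + 1) m
    · rw [Set.indicator_of_mem hq, Set.indicator_of_mem hq, one_mul]
      refine le_trans (le_of_eq ?_) (gauss_tail (c * m - q m + (β + 1)))
      rw [← lintegral_indicator_one (show MeasurableSet {s : ℝ | c * m - q m + (β + 1) - 1 ≤ s} from measurableSet_Ici)]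
      refine lintegral_congr fun s => ?_
      simp only [Set.indicator, Set.mem_setOf_eq, Pi.one_apply]
      congr 1
      rw [eq_iff_iff]
      push_cast
      constructor <;> intro <;> linarith
    · rw [Set.indicator_of_notMem hq, Set.indicator_of_notMem hq]; simp
  have hs : MeasurableSet {ω | c * (m + 1 : ℕ) + β ≤ S (m + 1) y ω ∧
      ∀ j ≤ m, S j y ω ≤ c * j + β + 1} := by
    refine (measurableSet_le measurable_const (h.meas _ y)).inter ?_
    have : {ω | ∀ j ≤ m, S j y ω ≤ c * j + β + 1} = ⋂ j : ℕ, ⋂ _ : j ≤ m, {ω | S j y ω ≤ c * j + β + 1} := by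
      ext ω; simp
    change MeasurableSet {ω | ∀ j ≤ m, S j y ω ≤ c * j + β + 1}
    rw [this]
    exact MeasurableSet.iInter fun j => MeasurableSet.iInter fun _ =>
      measurableSet_le (h.meas j y) measurable_const
  have hFω : Measurable fun ω => F (fun j => S (min j m) y ω) (S (m+1) y ω - S m y ω) :=
    hFm.comp ((h.past_meas y m).prodMk ((h.meas _ y).sub (h.meas _ y)))
  calc P {ω | c * (m + 1 : ℕ) + β ≤ S (m + 1) y ω ∧ ∀ j ≤ m, S j y ω ≤ c * j + β + 1}
      ≤ ∫⁻ ω, ENNReal.ofReal (Real.exp (- (d * (m + 1 : ℕ)) - c * β)) *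
        F (fun j => S (min j m) y ω) (S (m+1) y ω - S m y ω) ∂P := by
        rw [← lintegral_indicator_one hs]
        refine lintegral_mono fun ω => ?_
        by_cases hω : ω ∈ {ω | c * (m + 1 : ℕ) + β ≤ S (m + 1) y ω ∧ ∀ j ≤ m, S j y ω ≤ c * j + β + 1}
        · rw [Set.indicator_of_mem hω]
          have hB : (fun j => S (min j m) y ω) ∈ Bq c (β + 1) m := by
            intro j hj
            have := hω.2 j hj
            simp only [min_eq_left hj]; linarith
          have h0 : (S m y ω + (S (m+1) y ω - S m y ω) - (c * (m + 1 : ℕ) + β)) ∈ {s : ℝ | 0 ≤ s} := by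
            have := hω.1
            simp only [Set.mem_setOf_eq]; linarith
          simp only [hF, min_self]
          rw [Set.indicator_of_mem hB, Set.indicator_of_mem h0]
          simp only [Pi.one_apply, mul_one]
          rw [← ENNReal.ofReal_mul (by positivity), ← ENNReal.ofReal_mul (by positivity),
            ← Real.exp_add, ← Real.exp_add, ENNReal.one_le_ofReal]
          refine Real.one_le_exp ?_
          have h1 := mul_le_mul_of_nonneg_left hω.1 (Real.sqrt_nonneg (2 * (d:ℝ)))
          rw [← hc] at h1
          push_cast at h1 ⊢
          nlinarith
        · rw [Set.indicator_of_notMem hω]; exact zero_le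
    _ = ENNReal.ofReal (Real.exp (- (d * (m + 1 : ℕ)) - c * β)) *
         ∫⁻ ω, ∫⁻ ξ, F (fun j => S (min j m) y ω) ξ ∂gam ∂P := by
        rw [lintegral_const_mul _ hFω, h.step_gen y m hFm]
    _ ≤ ENNReal.ofReal (Real.exp (- (d * (m + 1 : ℕ)) - c * β)) *
         ∫⁻ ω, ENNReal.ofReal (Real.exp (3/2)) *
      wt c d (β + 1) (fun u => ENNReal.ofReal (Real.exp (-1 * u))) m (fun j => S j y ω) ∂P := by
        refine mul_le_mul_right (lintegral_mono fun ω => ?_) _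
        have h1 := hintgb (fun j => S (min j m) y ω)
        rw [wt_past c d (β + 1) (fun u => ENNReal.ofReal (Real.exp (-1 * u))) m (fun j => S j y ω)] at h1
        exact h1
    _ = _ := by
        have hw : Measurable fun ω => wt c d (β + 1) (fun u => ENNReal.ofReal (Real.exp (-1 * u))) m
            (fun j => S j y ω) := (wt_meas c d (β + 1) hφm m).comp (h.path_meas y)
        rw [lintegral_const_mul _ hw, hL,
          ENNReal.ofReal_mul (by positivity)]
        ring
end


def pt {d : ℕ} (J : ℝ) (l : ℕ) (i : Fin d → ℕ) : EE d :=
  WithLp.toLp 2 (fun a => -J + 2 * J * (i a) / 2 ^ l)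

def idx {d : ℕ} (J : ℝ) (l : ℕ) (x : EE d) : Fin d → ℕ := fun a => ⌊(x a + J) / (2 * J) * 2 ^ l⌋₊

def Qc (d : ℕ) (J : ℝ) : Set (EE d) := {x | ∀ a, -J ≤ x a ∧ x a < J}

section
variable {d : ℕ} {J : ℝ}

lemma pt_apply (l : ℕ) (i : Fin d → ℕ) (a : Fin d) : pt J l i a = -J + 2 * J * (i a) / 2 ^ l := rfl

lemma idx_lt (hJ : 0 < J) {x : EE d} (hx : x ∈ Qc d J) (l : ℕ) (a : Fin d) : idx J l x a < 2 ^ l := by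
  unfold idx
  have h1 := hx a
  rw [Nat.floor_lt (by have := h1.1; have : 0 ≤ x a + J := by linarith
                       positivity)]
  push_cast
  have : (x a + J) / (2 * J) < 1 := by rw [div_lt_one (by linarith)]; linarith
  nlinarith [show (0:ℝ) < 2 ^ l by positivity]

lemma idx_half (l : ℕ) (x : EE d) : idx J l x = fun a => idx J (l + 1) x a / 2 := by
  funext a
  unfold idx
  rw [← Nat.floor_div_natCast]
  congr 1
  push_cast
  rw [pow_succ]
  ring

lemma pt_mem (hJ : 0 < J) {l : ℕ} {i : Fin d → ℕ} (hi : ∀ a, i a < 2 ^ l) : pt J l i ∈ Qc d J := by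
  intro a
  rw [pt_apply]
  have h1 : ((i a : ℕ) : ℝ) < 2 ^ l := by exact_mod_cast hi a
  have h2 : 0 ≤ 2 * J * (i a) / 2 ^ l := by positivity
  have h3 : 2 * J * (i a) / 2 ^ l < 2 * J := by
    rw [div_lt_iff₀ (by positivity)]
    gcongr
  constructor <;> linarith

lemma euc_norm_le {x : EE d} {r : ℝ} (h : ∀ a, |x a| ≤ r) : ‖x‖ ≤ d * r := by
  have h1 : ‖x‖ ≤ ∑ a, ‖x a‖ := by
    have hx : x = ∑ a, EuclideanSpace.single a (x a) := by
      ext b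
      simp [Finset.sum_apply]
    calc ‖x‖ = ‖∑ a, EuclideanSpace.single a (x a)‖ := by rw [← hx]
      _ ≤ ∑ a, ‖EuclideanSpace.single a (x a)‖ := norm_sum_le _ _
      _ = _ := by simp
  refine h1.trans ?_
  calc ∑ a, ‖x a‖ ≤ ∑ _a : Fin d, r := Finset.sum_le_sum fun a _ => h a
    _ = _ := by simp

lemma pt_dist (hJ : 0 < J) (l : ℕ) (i : Fin d → ℕ) :
    ‖pt J (l + 1) i - pt J l (fun a => i a / 2)‖ ≤ d * (J / 2 ^ l) := by
  refine euc_norm_le fun a => ?_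
  change |pt J (l + 1) i a - pt J l (fun a => i a / 2) a| ≤ _
  rw [pt_apply, pt_apply]
  obtain ⟨q, r, hq, hr⟩ : ∃ q r : ℕ, i a = 2 * q + r ∧ r < 2 := ⟨i a / 2, i a % 2, by omega, by omega⟩
  have h2 : i a / 2 = q := by omega
  rw [h2, hq]
  have hr' : (r : ℝ) ≤ 1 := by exact_mod_cast (by omega : r ≤ 1)
  have : -J + 2 * J * ((2 * q + r : ℕ) : ℝ) / 2 ^ (l + 1) - (-J + 2 * J * (q : ℝ) / 2 ^ l) = J / 2 ^ l * r := by
    push_cast; rw [pow_succ]; field_simp; ring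
  rw [this, abs_of_nonneg (by positivity)]
  exact mul_le_of_le_one_right (by positivity) hr'

lemma pt_tendsto (hJ : 0 < J) {x : EE d} (hx : x ∈ Qc d J) :
    Tendsto (fun l => pt J l (idx J l x)) atTop (nhds x) := by
  rw [tendsto_iff_norm_sub_tendsto_zero]
  have hb : ∀ l, ‖pt J l (idx J l x) - x‖ ≤ d * (2 * J * (1 / 2) ^ l) := by
    intro l
    refine euc_norm_le fun a => ?_
    change |pt J l (idx J l x) a - x a| ≤ _
    rw [pt_apply]
    have h1 := hx a
    set z := (x a + J) / (2 * J) * 2 ^ l with hz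
    have hz0 : 0 ≤ z := by have : 0 ≤ x a + J := by linarith
                           positivity
    have hxa : x a = -J + 2 * J * z / 2 ^ l := by rw [hz]; field_simp; ring
    have h2 : (idx J l x a : ℝ) ≤ z := Nat.floor_le hz0
    have h3 : z < (idx J l x a : ℝ) + 1 := Nat.lt_floor_add_one z
    have h4 : -J + 2 * J * (idx J l x a : ℝ) / 2 ^ l - x a = (2 * J * (1 / 2) ^ l) * ((idx J l x a : ℝ) - z) := by
      rw [hxa, one_div, inv_pow]; field_simp; ring
    rw [h4, abs_mul, abs_of_nonneg (by positivity)]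
    refine mul_le_of_le_one_right (by positivity) ?_
    rw [abs_le]; constructor <;> linarith
  refine squeeze_zero (fun _ => norm_nonneg _) hb ?_
  have := (tendsto_pow_atTop_nhds_zero_of_lt_one (r := (1/2:ℝ)) (by norm_num) (by norm_num)).const_mul (2 * J)
  simpa using this.const_mul (d:ℝ)

lemma chain_det (hJ : 0 < J) {f : EE d → ℝ} (hf : Continuous f) {x : EE d} (hx : x ∈ Qc d J) {u : ℝ}
    (hu : u + 1 < f x) (l0 : ℕ) :
    (∃ i : Fin d → Fin (2 ^ l0), u ≤ f (pt J l0 (fun a => i a))) ∨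
    ∃ j : ℕ, ∃ i : Fin d → Fin (2 ^ (l0 + j + 1)), u ≤ f (pt J (l0 + j + 1) (fun a => i a)) ∧
      1 / 10 * (9 / 10) ^ j ≤ f (pt J (l0 + j + 1) (fun a => i a)) -
        f (pt J (l0 + j) (fun a => (i a : ℕ) / 2)) := by
  by_contra hcon
  push Not at hcon
  obtain ⟨hc1, hc2⟩ := hcon
  set g : ℕ → ℝ := fun j => f (pt J (l0 + j) (idx J (l0 + j) x)) with hg
  have hstep : ∀ j, u ≤ g (j + 1) → g (j + 1) - g j < 1 / 10 * (9 / 10) ^ j := by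
    intro j hj
    have := hc2 j (fun a => ⟨idx J (l0 + j + 1) x a, idx_lt hJ hx _ a⟩) hj
    simp only at this
    rw [← idx_half (l0 + j) x] at this
    exact this
  have hlim : Tendsto g atTop (nhds (f x)) := by
    have h1 := (hf.tendsto x).comp (pt_tendsto hJ hx)
    have h2 := h1.comp (tendsto_add_atTop_nat l0)
    refine h2.congr fun j => ?_
    simp [hg, add_comm]
  obtain ⟨L, hL⟩ := (hlim.eventually (lt_mem_nhds hu)).exists
  have hdown : ∀ k j, j + k = L → u + (1 - (9 / 10) ^ j) ≤ g j := by
    intro k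
    induction k with
    | zero =>
      intro j hj
      have : j = L := by omega
      subst this
      have : (0:ℝ) < (9 / 10) ^ j := by positivity
      linarith
    | succ k ih =>
      intro j hj
      have h1 := ih (j + 1) (by omega)
      have h3 : ((9:ℝ) / 10) ^ (j + 1) ≤ 1 := pow_le_one₀ (by norm_num) (by norm_num)
      have h2 := hstep j (by linarith)
      rw [pow_succ] at h1
      linarith
  have h0 := hdown L 0 (by omega)
  have h1 := hc1 (fun a => ⟨idx J l0 x a, idx_lt hJ hx _ a⟩)
  simp [hg] at h0
  change f (pt J l0 (idx J l0 x)) < u at h1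
  linarith
end


section
variable {d : ℕ} {Ω : Type*} [MeasurableSpace Ω] {P : Measure Ω} [IsProbabilityMeasure P]
  {S : ℕ → EE d → Ω → ℝ} {R C0 J : ℝ}

lemma nsmul_ofReal (k : ℕ) (r : ℝ) : k • ENNReal.ofReal r = ENNReal.ofReal (k * r) := by
  rw [nsmul_eq_mul, ENNReal.ofReal_mul (by positivity), ENNReal.ofReal_natCast]

lemma DW.bad_prob (h : DW d P S R C0) (hC0 : 0 ≤ C0) (hJ : 0 < J) (a0 : ℝ) (ha0 : 1 < a0)
    (ha0d : a0 ^ (2 * d) ≤ 21 / 20) (β : ℝ) (hβ : 0 ≤ β) (m : ℕ) :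
    P {ω | (∃ x ∈ Qc d J, √(2 * d) * (m + 1 : ℕ) + β + 1 < S (m + 1) x ω) ∧
      ∀ j ≤ m, ∀ x' ∈ Qc d J, S j x' ω ≤ √(2 * d) * j + β + 1} ≤
    ENNReal.ofReal (2 ^ d * Real.exp (3/2) * Real.exp (-(√(2 * d) * β))) *
      (ENNReal.ofReal ((21/20) ^ (Nat.log 2 m)) *
        G^[m] (fun u => ENNReal.ofReal (Real.exp (-1 * u))) (β + 1)) +
    ENNReal.ofReal (Real.exp (-(√(2 * d) * β))) *
     ∑' j : ℕ, ENNReal.ofReal (4 ^ d * Real.exp ((√(2 * d) + 1) * (C0 * (d * J))) *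
      ((a0 ^ 2) ^ (Nat.log 2 m) * 2 ^ j) ^ d * Real.exp (-(1 / 10 * a0 ^ (Nat.log 2 m) * (6 / 5) ^ j))) := by
  set c := √(2 * (d:ℝ)) with hc
  have hc0 : 0 ≤ c := Real.sqrt_nonneg _
  have hc2 : c ^ 2 = 2 * d := csq d
  set i0 := Nat.log 2 m with hi0
  set n := m + 1 with hn
  set y := Real.exp n * (a0 ^ 2) ^ i0 with hy
  have ha2 : 1 ≤ (a0 ^ 2) ^ i0 := one_le_pow₀ (one_le_pow₀ ha0.le)
  have hexpn : 1 ≤ Real.exp n := Real.one_le_exp (by positivity)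
  have hy1 : 1 ≤ y := one_le_mul_of_one_le_of_one_le hexpn ha2
  obtain ⟨l', hl1, hl2⟩ := exists_nat_pow_near hy1 (one_lt_two)
  set l := l' + 1 with hl
  have hl3 : (2:ℝ) ^ l ≤ 2 * y := by rw [hl, pow_succ]; linarith
  -- covering
  have hsub : {ω | (∃ x ∈ Qc d J, c * (n : ℕ) + β + 1 < S n x ω) ∧
      ∀ j ≤ m, ∀ x' ∈ Qc d J, S j x' ω ≤ c * j + β + 1} ⊆
      (⋃ i : Fin d → Fin (2 ^ l), {ω | c * n + β ≤ S n (pt J l (fun a => i a)) ω ∧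
        ∀ j ≤ m, S j (pt J l (fun a => i a)) ω ≤ c * j + β + 1}) ∪
      ⋃ j : ℕ, ⋃ i : Fin d → Fin (2 ^ (l + j + 1)),
        {ω | c * n + β ≤ S n (pt J (l + j + 1) (fun a => i a)) ω ∧
          1 / 10 * (9 / 10) ^ j ≤ S n (pt J (l + j + 1) (fun a => i a)) ω -
            S n (pt J (l + j) (fun a => (i a : ℕ) / 2)) ω} := by
    rintro ω ⟨⟨x, hx, hxu⟩, hω⟩
    rcases chain_det hJ (h.cont n ω) hx hxu l with ⟨i, hi⟩ | ⟨j, i, hi⟩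
    · left
      refine Set.mem_iUnion.2 ⟨i, hi, fun j hj => hω j hj _ (pt_mem hJ fun a => (i a).2)⟩
    · right
      exact Set.mem_iUnion.2 ⟨j, Set.mem_iUnion.2 ⟨i, hi⟩⟩
  refine (measure_mono hsub).trans ((measure_union_le _ _).trans (add_le_add ?_ ?_))
  · refine (measure_iUnion_fintype_le _ _).trans ?_
    refine (Finset.sum_le_card_nsmul _ _ _ fun i _ => h.first_prob m _ β hβ).trans ?_
    rw [← smul_mul_assoc, nsmul_ofReal, ← mul_assoc (ENNReal.ofReal (2 ^ d * _ * _)),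
      ← ENNReal.ofReal_mul (by positivity)]
    refine mul_le_mul_left (ENNReal.ofReal_le_ofReal ?_) _
    simp only [Finset.card_univ, Fintype.card_fun, Fintype.card_fin]
    push_cast
    have h1 : ((2:ℝ) ^ l) ^ d ≤ 2 ^ d * Real.exp (d * n) * (21 / 20) ^ i0 := by
      calc ((2:ℝ) ^ l) ^ d ≤ (2 * y) ^ d := by gcongr
        _ = 2 ^ d * Real.exp (d * n) * (a0 ^ (2 * d)) ^ i0 := by
          rw [hy, mul_pow, mul_pow, Real.exp_nat_mul]; ring
        _ ≤ _ := by gcongr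
    have h2 : Real.exp (-(d * (n:ℝ)) - c * β) = Real.exp (-(c * β)) / Real.exp (d * n) := by
      rw [← Real.exp_sub]; ring_nf
    have h3 : ((m:ℝ) + 1) = n := by rw [hn]; push_cast; ring
    rw [h3, h2]
    calc ((2:ℝ) ^ l) ^ d * (Real.exp (3 / 2) * (Real.exp (-(c * β)) / Real.exp (d * n)))
        ≤ (2 ^ d * Real.exp (d * n) * (21 / 20) ^ i0) * (Real.exp (3 / 2) * (Real.exp (-(c * β)) / Real.exp (d * n))) := by
          gcongr
      _ = _ := by field_simp
  · rw [← ENNReal.tsum_mul_left]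
    refine (measure_iUnion_le _).trans (ENNReal.tsum_le_tsum fun j => ?_)
    refine (measure_iUnion_fintype_le _ _).trans ?_
    set lam := a0 ^ i0 * (4 / 3) ^ j with hlam
    have hlam0 : 0 ≤ lam := by positivity
    set w := (a0 ^ 2) ^ i0 * (2:ℝ) ^ j with hw
    have hw0 : 0 < w := by positivity
    have hlam2 : lam ^ 2 ≤ w := by
      rw [hlam, hw, mul_pow, ← pow_mul, ← pow_mul, ← pow_mul, mul_comm i0 2, mul_comm j 2,
        pow_mul (4/3:ℝ)]
      gcongr
      norm_num
    have hlam1 : lam ≤ w := by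
      rw [hlam, hw]
      gcongr
      · exact le_self_pow₀ ha0.le (by norm_num)
      · norm_num
    have hpt : ∀ i : Fin d → Fin (2 ^ (l + j + 1)), P {ω | c * n + β ≤ S n (pt J (l + j + 1) (fun a => i a)) ω ∧
          1 / 10 * (9 / 10) ^ j ≤ S n (pt J (l + j + 1) (fun a => i a)) ω -
            S n (pt J (l + j) (fun a => (i a : ℕ) / 2)) ω} ≤
        ENNReal.ofReal (Real.exp (-(d * n)) * Real.exp (-(c * β)) * Real.exp ((c + 1) * (C0 * (d * J))) *
          Real.exp (-(1 / 10 * a0 ^ i0 * (6 / 5) ^ j))) := by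
      intro i
      refine (h.chain_prob n _ _ lam hlam0 _ _).trans ?_
      rw [← ENNReal.ofReal_mul (by positivity), ← Real.exp_add, ← Real.exp_add, ← Real.exp_add, ← Real.exp_add]
      refine ENNReal.ofReal_le_ofReal (Real.exp_le_exp.2 ?_)
      have hdist := pt_dist hJ (l + j) (fun a => (i a : ℕ))
      set D := ‖pt J (l + j + 1) (fun a => (i a : ℕ)) - pt J (l + j) (fun a => (i a : ℕ) / 2)‖ with hD
      have h1 : Real.exp n * D ≤ (d * J) / w := by
        rw [le_div_iff₀ hw0]
        calc Real.exp n * D * w ≤ Real.exp n * (d * (J / 2 ^ (l + j))) * w := by gcongr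
          _ = d * J * (y / 2 ^ l) := by rw [hy, hw, pow_add]; field_simp
          _ ≤ d * J * 1 := by
              gcongr
              rw [div_le_one (by positivity)]
              exact hl2.le
          _ = _ := mul_one _
      have h2 : (c * lam + lam ^ 2) * (C0 * (Real.exp n * D)) ≤ (c + 1) * (C0 * (d * J)) := by
        calc (c * lam + lam ^ 2) * (C0 * (Real.exp n * D)) ≤ (c * w + w) * (C0 * ((d * J) / w)) := by
              gcongr
          _ = _ := by field_simp
      have h3 : lam * (1 / 10 * (9 / 10) ^ j) = 1 / 10 * a0 ^ i0 * (6 / 5) ^ j := by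
        rw [hlam, show (6/5:ℝ) = 4/3 * (9/10) by norm_num, mul_pow]; ring
      rw [h3]
      have h4 : c * (c * n + β) = 2 * d * n + c * β := by linear_combination (n:ℝ) * hc2
      rw [h4]
      linarith
    refine (Finset.sum_le_card_nsmul _ _ _ fun i _ => hpt i).trans ?_
    rw [nsmul_ofReal, ← ENNReal.ofReal_mul (by positivity)]
    refine ENNReal.ofReal_le_ofReal ?_
    simp only [Finset.card_univ, Fintype.card_fun, Fintype.card_fin]
    push_cast
    have h1 : ((2:ℝ) ^ (l + j + 1)) ^ d ≤ 4 ^ d * Real.exp (d * n) * w ^ d := by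
      calc ((2:ℝ) ^ (l + j + 1)) ^ d = (2 ^ l * (2 * 2 ^ j)) ^ d := by ring
        _ ≤ ((2 * y) * (2 * 2 ^ j)) ^ d := by gcongr
        _ = (4 * (Real.exp n * w)) ^ d := by rw [hy, hw]; ring
        _ = _ := by rw [Real.exp_nat_mul, mul_pow, mul_pow]; ring
    rw [Real.exp_neg (d * (n:ℝ))]
    calc ((2:ℝ) ^ (l + j + 1)) ^ d * ((Real.exp (d * n))⁻¹ * Real.exp (-(c * β)) * Real.exp ((c + 1) * (C0 * (d * J))) *
          Real.exp (-(1 / 10 * a0 ^ i0 * (6 / 5) ^ j)))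
        ≤ (4 ^ d * Real.exp (d * n) * w ^ d) * ((Real.exp (d * n))⁻¹ * Real.exp (-(c * β)) * Real.exp ((c + 1) * (C0 * (d * J))) *
          Real.exp (-(1 / 10 * a0 ^ i0 * (6 / 5) ^ j))) := by gcongr
      _ = _ := by field_simp
end

lemma log_sum : ∑' m : ℕ, ENNReal.ofReal ((1 / 4) ^ (Nat.log 2 m)) ≠ ⊤ := by
  have hs : Summable fun m : ℕ => (4:ℝ) / ((m:ℝ) ) ^ 2 :=
    (Real.summable_nat_pow_inv.2 one_lt_two).mul_left 4
  have hs2 : Summable fun m : ℕ => ((1:ℝ) / 4) ^ (Nat.log 2 m) := by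
    rw [← summable_nat_add_iff 1] at hs ⊢
    refine Summable.of_nonneg_of_le (fun _ => by positivity) (fun m => ?_) hs
    have h1 : m + 1 < 2 ^ (Nat.log 2 (m + 1) + 1) := Nat.lt_pow_succ_log_self one_lt_two _
    have h2 : ((m + 1 : ℕ) : ℝ) ≤ 2 * 2 ^ (Nat.log 2 (m + 1)) := by
      rw [← pow_succ']; exact_mod_cast h1.le
    rw [le_div_iff₀ (by positivity)]
    calc ((1:ℝ) / 4) ^ (Nat.log 2 (m + 1)) * ((m + 1 : ℕ) : ℝ) ^ 2
        ≤ ((1:ℝ) / 4) ^ (Nat.log 2 (m + 1)) * (2 * 2 ^ (Nat.log 2 (m + 1))) ^ 2 := by gcongr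
      _ = 4 * ((1/4) * 4) ^ (Nat.log 2 (m+1)) := by
        rw [mul_pow (1/4 : ℝ), mul_pow, ← pow_mul, mul_comm _ 2, pow_mul]; norm_num
        ring
      _ = 4 := by norm_num
  rw [← ENNReal.ofReal_tsum_of_nonneg (fun _ => by positivity) hs2]
  exact ENNReal.ofReal_ne_top

lemma chain_sum (d : ℕ) (a0 K : ℝ) (ha0 : 1 < a0) (hK : 0 ≤ K) :
    ∑' m : ℕ, ∑' j : ℕ, ENNReal.ofReal (K *
      ((a0 ^ 2) ^ (Nat.log 2 m) * 2 ^ j) ^ d * Real.exp (-(1 / 10 * a0 ^ (Nat.log 2 m) * (6 / 5) ^ j))) ≠ ⊤ := by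
  obtain ⟨p1, hp1⟩ := pow_unbounded_of_one_lt (4 * a0 ^ (2 * d)) ha0
  obtain ⟨p2, hp2⟩ := pow_unbounded_of_one_lt (2 * 2 ^ d) (show (1:ℝ) < 6 / 5 by norm_num)
  set p := max p1 p2 with hp
  have h1 : 4 * a0 ^ (2 * d) ≤ a0 ^ p := hp1.le.trans (pow_le_pow_right₀ ha0.le (le_max_left _ _))
  have h2 : (2:ℝ) * 2 ^ d ≤ (6 / 5) ^ p := hp2.le.trans (pow_le_pow_right₀ (by norm_num) (le_max_right _ _))
  have key : ∀ m j : ℕ, K * ((a0 ^ 2) ^ (Nat.log 2 m) * 2 ^ j) ^ d *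
      Real.exp (-(1 / 10 * a0 ^ (Nat.log 2 m) * (6 / 5) ^ j)) ≤
      (K * (p.factorial * 10 ^ p)) * ((1 / 2) ^ j) * (1 / 4) ^ (Nat.log 2 m) := by
    intro m j
    set i := Nat.log 2 m
    set u := 1 / 10 * a0 ^ i * (6 / 5) ^ j with hu
    have hu0 : 0 < u := by positivity
    have h3 := Real.pow_div_factorial_le_exp u hu0.le p
    have h4 : Real.exp (-u) ≤ p.factorial / u ^ p := by
      rw [Real.exp_neg, ← inv_div]
      exact inv_anti₀ (by positivity) h3
    have h5 : (4 * a0 ^ (2 * d)) ^ i ≤ (a0 ^ p) ^ i := by gcongr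
    have h6 : ((2:ℝ) * 2 ^ d) ^ j ≤ ((6 / 5) ^ p) ^ j := by gcongr
    have h7 : u ^ p = (a0 ^ p) ^ i * ((6 / 5) ^ p) ^ j / 10 ^ p := by
      rw [hu]; rw [mul_pow, mul_pow, one_div, inv_pow, ← pow_mul, ← pow_mul, ← pow_mul, ← pow_mul, mul_comm i p, mul_comm j p]
      field_simp
    have h8 : ((a0 ^ 2) ^ i * (2:ℝ) ^ j) ^ d = (4 * a0 ^ (2 * d)) ^ i * (2 * 2 ^ d) ^ j * ((1/2) ^ j * (1/4) ^ i) := by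
      rw [mul_pow 4, mul_pow 2, mul_pow _ _ d, one_div, one_div, inv_pow, inv_pow]
      field_simp
      ring
    calc K * ((a0 ^ 2) ^ i * 2 ^ j) ^ d * Real.exp (-u)
        ≤ K * ((a0 ^ 2) ^ i * 2 ^ j) ^ d * (p.factorial / u ^ p) := by gcongr
      _ = (K * (p.factorial * 10 ^ p) * (1/2) ^ j * (1/4) ^ i) *
          (((4 * a0 ^ (2 * d)) ^ i * (2 * 2 ^ d) ^ j) / ((a0 ^ p) ^ i * ((6 / 5) ^ p) ^ j)) := by
          rw [h8, h7]; field_simp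
      _ ≤ (K * (p.factorial * 10 ^ p) * (1/2) ^ j * (1/4) ^ i) * 1 := by
          gcongr
          rw [div_le_one (by positivity)]
          gcongr
      _ = _ := mul_one _
  have hj : Summable fun j : ℕ => ((1:ℝ) / 2) ^ j := summable_geometric_of_lt_one (by norm_num) (by norm_num)
  refine ne_top_of_le_ne_top ?_ (ENNReal.tsum_le_tsum fun m => ENNReal.tsum_le_tsum fun j =>
    ENNReal.ofReal_le_ofReal (key m j))
  have e : ∀ m : ℕ, ∑' j : ℕ, ENNReal.ofReal ((K * (p.factorial * 10 ^ p)) * ((1 / 2) ^ j) * (1 / 4) ^ (Nat.log 2 m))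
      = (∑' j : ℕ, ENNReal.ofReal ((K * (p.factorial * 10 ^ p)) * ((1 / 2) ^ j))) * ENNReal.ofReal ((1 / 4) ^ (Nat.log 2 m)) := by
    intro m
    rw [← ENNReal.tsum_mul_right]
    exact tsum_congr fun j => ENNReal.ofReal_mul (by positivity)
  simp_rw [e]
  rw [ENNReal.tsum_mul_left]
  refine ENNReal.mul_ne_top ?_ log_sum
  rw [← ENNReal.ofReal_tsum_of_nonneg (fun _ => by positivity) (hj.mul_left _)]
  exact ENNReal.ofReal_ne_top


section
variable {d : ℕ} {Ω : Type*} [MeasurableSpace Ω] {P : Measure Ω} [IsProbabilityMeasure P]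
  {S : ℕ → EE d → Ω → ℝ} {R C0 J : ℝ}

lemma DW.zero_all (h : DW d P S R C0) : ∀ᵐ ω ∂P, ∀ x, S 0 x ω = 0 := by
  have h1 : ∀ᵐ ω ∂P, ∀ k : ℕ, S 0 (TopologicalSpace.denseSeq (EE d) k) ω = 0 :=
    ae_all_iff.2 fun k => h.zero _
  filter_upwards [h1] with ω hω
  have := (TopologicalSpace.denseRange_denseSeq (EE d)).equalizer (h.cont 0 ω) continuous_const
    (funext hω)
  exact fun x => congrFun this x

lemma DW.barrier (h : DW d P S R C0) (hd : 1 ≤ d) (hC0 : 0 ≤ C0) (hJ : 0 < J) :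
    ∀ᵐ ω ∂P, ∃ b : ℕ, ∀ n : ℕ, ∀ x ∈ Qc d J, 0 ≤ √(2 * d) * n - S n x ω + b := by
  have hd' : (1:ℝ) ≤ d := by exact_mod_cast hd
  have hc1 : 1 ≤ √(2 * (d:ℝ)) := Real.one_le_sqrt.2 (by linarith)
  obtain ⟨a0, ha0, ha0d⟩ : ∃ a0 : ℝ, 1 < a0 ∧ a0 ^ (2 * d) ≤ 21 / 20 := by
    refine ⟨(21 / 20 : ℝ) ^ ((1:ℝ) / ((2 * d : ℕ) : ℝ)), Real.one_lt_rpow (by norm_num) (by positivity), ?_⟩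
    rw [← Real.rpow_natCast, ← Real.rpow_mul (by norm_num), one_div, inv_mul_cancel₀ (by positivity), Real.rpow_one]
  obtain ⟨C, hC, hpot⟩ := pot 1 one_pos
  have hT := chain_sum d a0 (4 ^ d * Real.exp ((√(2 * d) + 1) * (C0 * (d * J)))) ha0 (by positivity)
  set T := ∑' m : ℕ, ∑' j : ℕ, ENNReal.ofReal (4 ^ d * Real.exp ((√(2 * d) + 1) * (C0 * (d * J))) *
      ((a0 ^ 2) ^ (Nat.log 2 m) * 2 ^ j) ^ d * Real.exp (-(1 / 10 * a0 ^ (Nat.log 2 m) * (6 / 5) ^ j))) with hTdef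
  set K := ENNReal.ofReal (2 ^ d * Real.exp (3/2) * (C * 2)) + T with hK
  have hbad : ∀ β : ℕ, P {ω | ¬ ∃ b : ℕ, ∀ n : ℕ, ∀ x ∈ Qc d J, 0 ≤ √(2 * d) * n - S n x ω + b}
      ≤ K * ENNReal.ofReal (Real.exp (-((1:ℝ) / 2) * β)) := by
    intro β
    have hβ : (0:ℝ) ≤ β := by positivity
    have hsub : {ω | ¬ ∃ b : ℕ, ∀ n : ℕ, ∀ x ∈ Qc d J, 0 ≤ √(2 * d) * n - S n x ω + b} ⊆
        {ω | ¬ ∀ x, S 0 x ω = 0} ∪ ⋃ m : ℕ,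
        {ω | (∃ x ∈ Qc d J, √(2 * d) * (m + 1 : ℕ) + β + 1 < S (m + 1) x ω) ∧
      ∀ j ≤ m, ∀ x' ∈ Qc d J, S j x' ω ≤ √(2 * d) * j + β + 1} := by
      intro ω hω
      by_cases h0 : ∀ x, S 0 x ω = 0
      · right
        have hex : ∃ n : ℕ, ∃ x ∈ Qc d J, √(2 * d) * n + β + 1 < S n x ω := by
          by_contra hcon
          push Not at hcon
          refine hω ⟨β + 1, fun n x hx => ?_⟩
          have := hcon n x hx
          push_cast; linarith
        classical
        have hn1 := Nat.find_spec hex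
        have hn2 : ∀ j, j < Nat.find hex → _ := fun j hj => Nat.find_min hex hj
        rcases hn : Nat.find hex with _ | m
        · rw [hn] at hn1
          obtain ⟨x, hx, hx1⟩ := hn1
          rw [h0 x] at hx1
          simp at hx1; linarith
        · rw [hn] at hn1 hn2
          refine Set.mem_iUnion.2 ⟨m, hn1, fun j hj x' hx' => ?_⟩
          have := hn2 j (by omega)
          push Not at this
          exact this x' hx'
      · left; exact h0
    refine (measure_mono hsub).trans ((measure_union_le _ _).trans ?_)
    rw [show P {ω | ¬ ∀ x, S 0 x ω = 0} = 0 from h.zero_all, zero_add]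
    refine (measure_iUnion_le _).trans ?_
    refine (ENNReal.tsum_le_tsum fun m => h.bad_prob hC0 hJ a0 ha0 ha0d β hβ m).trans ?_
    rw [ENNReal.tsum_add, ENNReal.tsum_mul_left, ENNReal.tsum_mul_left, ← hTdef, hK, add_mul]
    have h1 : Real.exp (-(√(2 * d) * β)) ≤ Real.exp (-((1:ℝ) / 2) * β) * Real.exp (-((1:ℝ) / 2) * β) := by
      rw [← Real.exp_add]; exact Real.exp_le_exp.2 (by nlinarith)
    have h2 : (β:ℝ) + 1 + 1 ≤ 2 * Real.exp ((1:ℝ) / 2 * β) := by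
      have := Real.add_one_le_exp ((1:ℝ) / 2 * β)
      linarith
    have h3 : Real.exp (-((1:ℝ) / 2) * β) ≤ 1 := Real.exp_le_one_iff.2 (by nlinarith)
    have h4 : Real.exp (-((1:ℝ) / 2) * β) * Real.exp ((1:ℝ) / 2 * β) = 1 := by
      rw [← Real.exp_add]; simp
    refine add_le_add ?_ ?_
    · refine (mul_le_mul_right (hpot (β + 1) (by positivity)) _).trans ?_
      rw [← ENNReal.ofReal_mul (by positivity), ← ENNReal.ofReal_mul (by positivity)]
      refine ENNReal.ofReal_le_ofReal ?_
      calc 2 ^ d * Real.exp (3 / 2) * Real.exp (-(√(2 * d) * β)) * (C * (β + 1 + 1))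
          ≤ 2 ^ d * Real.exp (3 / 2) * (Real.exp (-((1:ℝ) / 2) * β) * Real.exp (-((1:ℝ) / 2) * β)) *
            (C * (2 * Real.exp ((1:ℝ) / 2 * β))) := by gcongr
        _ = 2 ^ d * Real.exp (3 / 2) * (C * 2) * Real.exp (-((1:ℝ) / 2) * β) *
            (Real.exp (-((1:ℝ) / 2) * β) * Real.exp ((1:ℝ) / 2 * β)) := by ring
        _ = _ := by rw [h4, mul_one]
    · rw [mul_comm]
      refine mul_le_mul_right (ENNReal.ofReal_le_ofReal (h1.trans ?_)) _
      exact mul_le_of_le_one_right (Real.exp_pos _).le h3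
  have hKtop : K ≠ ⊤ := ENNReal.add_ne_top.2 ⟨ENNReal.ofReal_ne_top, hT⟩
  have hlim : Tendsto (fun β : ℕ => K * ENNReal.ofReal (Real.exp (-((1:ℝ) / 2) * β))) atTop (nhds 0) := by
    have h1 : Tendsto (fun β : ℕ => Real.exp (-((1:ℝ) / 2) * β)) atTop (nhds 0) := by
      refine Real.tendsto_exp_atBot.comp ?_
      exact (tendsto_natCast_atTop_atTop).const_mul_atTop_of_neg (by norm_num)
    have h2 := ENNReal.tendsto_ofReal h1
    rw [ENNReal.ofReal_zero] at h2
    simpa using ENNReal.Tendsto.const_mul h2 (Or.inr hKtop)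
  exact le_antisymm (ge_of_tendsto' hlim hbad) zero_le
end


section
variable {d : ℕ} {Ω : Type*} [MeasurableSpace Ω] {P : Measure Ω} [IsProbabilityMeasure P]
  {S : ℕ → EE d → Ω → ℝ} {R C0 J : ℝ}

lemma ball_sub_Qc (J : ℝ) : Metric.ball (0 : EE d) J ⊆ Qc d J := by
  intro x hx a
  rw [mem_ball_zero_iff] at hx
  have h1 : |x a| ≤ ‖x‖ := PiLp.norm_apply_le x a
  have := abs_lt.1 (lt_of_le_of_lt h1 hx)
  exact ⟨this.1.le, this.2⟩

lemma ofReal_int_le {α : Type*} [MeasurableSpace α] {μ : Measure α} {F : α → ℝ} (hF : Integrable F μ) :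
    ENNReal.ofReal (∫ x, F x ∂μ) ≤ ∫⁻ x, ENNReal.ofReal (F x) ∂μ := by
  have hp : Integrable (fun x => max (F x) 0) μ := hF.pos_part
  have h1 : ∫ x, F x ∂μ ≤ ∫ x, max (F x) 0 ∂μ := integral_mono hF hp fun x => le_max_left _ _
  refine (ENNReal.ofReal_le_ofReal h1).trans ?_
  rw [ofReal_integral_eq_lintegral_ofReal hp (Eventually.of_forall fun x => le_max_right _ _)]
  refine lintegral_mono fun x => ?_
  simp

lemma DW.path_end (h : DW d P S R C0) (hR : 0 < R) (A : ℝ) (hA : 1 ≤ A) (b : ℝ) (hb0 : 0 ≤ b) (ω : Ω)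
    (hb : ∀ n : ℕ, ∀ x ∈ Qc d J, 0 ≤ √(2 * d) * n - S n x ω + b)
    (hI : ⨅ m0 : ℕ, liminf (fun N => II S R A b J N m0 ω) atTop = 0)
    (μ : Measure (EE d)) (hμ : IsLocallyFiniteMeasure μ)
    (hlim : ∀ f : EE d → ℝ, Continuous f → HasCompactSupport f →
      Tendsto (fun N : ℕ => ∫ x, f x * ((√(2 * d) * N - S N x ω) * Real.exp (√(2 * d) * S N x ω - d * N)))
        atTop (nhds (∫ x, f x ∂μ)))
    (x : EE d) (hx : x ∈ Metric.ball (0 : EE d) J) : μ {x} = 0 := by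
  by_contra hne
  have hfin : μ {x} ≠ ⊤ := (isCompact_singleton (x := x)).measure_lt_top.ne
  set ε := μ.real {x} with hε
  have hε0 : 0 < ε := ENNReal.toReal_pos hne hfin
  have hpos : 0 < (ENNReal.ofReal (ε / 2)) ^ 2 :=
    ENNReal.pow_pos (ENNReal.ofReal_pos.2 (by linarith)) 2
  rw [← hI] at hpos
  obtain ⟨m0, hm0⟩ := iInf_lt_iff.1 hpos
  obtain ⟨r1, hr1, hr1s⟩ := Metric.isOpen_iff.1 Metric.isOpen_ball x hx
  set r := min r1 (R * Real.exp (-m0) / 2) with hr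
  have hr0 : 0 < r := lt_min hr1 (by positivity)
  set B := Metric.ball x r with hB
  have hBJ : B ⊆ Metric.ball (0 : EE d) J := (Metric.ball_subset_ball (min_le_left _ _)).trans hr1s
  set W : ℕ → EE d → ENNReal := fun N y =>
    wt √(2 * d) d b (fun u => ENNReal.ofReal (u + A)) N (fun j => S j y ω) with hW
  have hWm : ∀ N, Measurable (W N) := fun N =>
    (h.joint_meas (c := √(2 * d)) (dd := d) (b := b)
      (show Measurable (fun u : ℝ => ENNReal.ofReal (u + A)) by fun_prop) N).comp measurable_prodMk_right
  -- lower bound on II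
  have hII : ∀ N, (∫⁻ y in B, W N y) ^ 2 ≤ II S R A b J N m0 ω := by
    intro N
    have hBm : MeasurableSet B := Metric.isOpen_ball.measurableSet
    have e1 : ∫⁻ y, B.indicator (W N) y ∂(volume.restrict (Metric.ball 0 J)) = ∫⁻ y in B, W N y := by
      rw [lintegral_indicator hBm, Measure.restrict_restrict hBm, Set.inter_eq_left.2 hBJ]
    have e2 : ∫⁻ y, B.indicator (W N) y = ∫⁻ y in B, W N y := lintegral_indicator hBm _
    have hm : AEMeasurable (B.indicator (W N)) volume := ((hWm N).indicator hBm).aemeasurable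
    have hm' : AEMeasurable (B.indicator (W N)) (volume.restrict (Metric.ball 0 J)) :=
      ((hWm N).indicator hBm).aemeasurable
    have e3 := lintegral_prod_mul hm' hm
    rw [e1, e2, ← sq] at e3
    rw [← e3]
    unfold II
    refine lintegral_mono fun p => ?_
    by_cases h1 : p.1 ∈ B
    · by_cases h2 : p.2 ∈ B
      · have hp : p ∈ {p : EE d × EE d | Real.exp m0 * ‖p.1 - p.2‖ < R} := by
          have h3 : dist p.1 p.2 < r + r := by
            have := dist_triangle_right p.1 p.2 x
            rw [hB, Metric.mem_ball] at h1 h2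
            linarith
          have h4 : r + r ≤ R * Real.exp (-m0) := by
            have : r ≤ R * Real.exp (-m0) / 2 := min_le_right _ _
            linarith
          have h5 : ‖p.1 - p.2‖ < R * Real.exp (-m0) := by rw [← dist_eq_norm]; linarith
          change Real.exp m0 * ‖p.1 - p.2‖ < R
          rw [Real.exp_neg, ← div_eq_mul_inv, lt_div_iff₀ (Real.exp_pos _)] at h5
          linarith
        rw [Set.indicator_of_mem h1, Set.indicator_of_mem h2, Set.indicator_of_mem hp]
      · rw [Set.indicator_of_notMem h2]; simp
    · rw [Set.indicator_of_notMem h1]; simp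
  -- test function
  set f : EE d → ℝ := fun y => max 0 (1 - ‖y - x‖ / r) with hf
  have hfc : Continuous f := by fun_prop
  have hf0 : ∀ y, 0 ≤ f y := fun y => le_max_left _ _
  have hf1 : ∀ y, f y ≤ 1 := fun y => max_le zero_le_one (by
    have : 0 ≤ ‖y - x‖ / r := by positivity
    linarith)
  have hfB : ∀ y, y ∉ B → f y = 0 := by
    intro y hy
    rw [hB, Metric.mem_ball, not_lt, dist_eq_norm] at hy
    refine max_eq_left ?_
    have : 1 ≤ ‖y - x‖ / r := (one_le_div hr0).2 hy
    linarith
  have hfx : f x = 1 := by simp [hf]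
  have hfs : HasCompactSupport f := by
    refine HasCompactSupport.of_support_subset_isCompact (isCompact_closedBall x r) fun y hy => ?_
    by_contra hcon
    exact hy (hfB y fun hh => hcon (Metric.ball_subset_closedBall hh))
  have hfμ : ε ≤ ∫ y, f y ∂μ := by
    have hintgb : Integrable f μ := hfc.integrable_of_hasCompactSupport hfs
    have := setIntegral_le_integral (s := {x}) hintgb (Eventually.of_forall hf0)
    rw [integral_singleton, hfx] at this
    simpa using this
  have hev : ∀ᶠ N : ℕ in atTop, ε / 2 < ∫ x, f x * ((√(2 * d) * N - S N x ω) *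
      Real.exp (√(2 * d) * S N x ω - d * N)) :=
    (hlim f hfc hfs).eventually (lt_mem_nhds (by linarith))
  have hle : ∀ᶠ N : ℕ in atTop, ENNReal.ofReal (ε / 2) ^ 2 ≤ II S R A b J N m0 ω := by
    filter_upwards [hev] with N hN
    refine le_trans ?_ (hII N)
    gcongr
    refine (ENNReal.ofReal_le_ofReal hN.le).trans ?_
    have hcN := h.cont N ω
    have hintgb : Integrable (fun x => f x * ((√(2 * d) * N - S N x ω) *
      Real.exp (√(2 * d) * S N x ω - d * N))) volume := by
      refine Continuous.integrable_of_hasCompactSupport (by fun_prop) ?_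
      exact hfs.mul_right
    refine (ofReal_int_le hintgb).trans ?_
    rw [← lintegral_indicator Metric.isOpen_ball.measurableSet]
    refine lintegral_mono fun y => ?_
    by_cases hy : y ∈ B
    · rw [Set.indicator_of_mem hy]
      have hyQ : y ∈ Qc d J := ball_sub_Qc J (hBJ hy)
      have hmem : (fun j => S j y ω) ∈ Bq √(2 * d) b N := fun j _ => hb j y hyQ
      simp only [hW]
      unfold wt
      rw [Set.indicator_of_mem hmem, ← ENNReal.ofReal_mul (by positivity)]
      refine ENNReal.ofReal_le_ofReal ?_
      have h0 := hb N y hyQ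
      set E := Real.exp (√(2 * d) * S N y ω - d * N) with hE
      have hE0 : 0 < E := Real.exp_pos _
      set Y := √(2 * d) * N - S N y ω
      calc f y * (Y * E) ≤ f y * ((Y + b + A) * E) := by
            refine mul_le_mul_of_nonneg_left (mul_le_mul_of_nonneg_right (by linarith) hE0.le) (hf0 y)
        _ ≤ 1 * ((Y + b + A) * E) := by
            refine mul_le_mul_of_nonneg_right (hf1 y) (mul_nonneg (by linarith) hE0.le)
        _ = _ := by ring
    · rw [hfB y hy]; simp
  have := le_liminf_of_le (by isBoundedDefault) hle
  exact absurd hm0 (not_lt.2 this)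
end


section
variable {d : ℕ}

def KK (k : EE d → ℝ) (t : ℝ) (z : EE d) : ℝ := ∫ u in Set.Icc (1:ℝ) (Real.exp t), k (u • z) / u

lemma KK_intble {k : EE d → ℝ} (hk : Continuous k) (t : ℝ) (z : EE d) :
    IntegrableOn (fun u : ℝ => k (u • z) / u) (Set.Icc (1:ℝ) (Real.exp t)) := by
  apply ContinuousOn.integrableOn_Icc
  intro u hu
  have : u ≠ 0 := by have := hu.1; positivity
  apply ContinuousAt.continuousWithinAt
  have h2 : Continuous fun u : ℝ => k (u • z) := by fun_prop
  exact h2.continuousAt.div continuousAt_id this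

lemma KK_zero {k : EE d → ℝ} (hk0 : k 0 = 1) {t : ℝ} (ht : 0 ≤ t) : KK k t 0 = t := by
  unfold KK
  simp only [smul_zero, hk0]
  rw [integral_Icc_eq_integral_Ioc, ← intervalIntegral.integral_of_le (Real.one_le_exp ht),
    integral_one_div_of_pos one_pos (Real.exp_pos t)]
  simp

lemma KK_lip {k : EE d → ℝ} (hk : Continuous k) (hk0 : k 0 = 1) {C : NNReal} (hC : LipschitzWith C k)
    {t : ℝ} (ht : 0 ≤ t) (z : EE d) : t - KK k t z ≤ C * (Real.exp t * ‖z‖) := by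
  nth_rewrite 1 [← KK_zero hk0 ht]
  unfold KK
  rw [← integral_sub (KK_intble hk t 0) (KK_intble hk t z)]
  have h1 : ∫ u in Set.Icc (1:ℝ) (Real.exp t), (k (u • (0 : EE d)) / u - k (u • z) / u)
      ≤ ∫ u in Set.Icc (1:ℝ) (Real.exp t), (C * ‖z‖ : ℝ) := by
    apply setIntegral_mono_on ((KK_intble hk t 0).sub (KK_intble hk t z)) _ measurableSet_Icc
    · intro u hu
      have hu0 : 0 < u := lt_of_lt_of_le one_pos hu.1
      show k (u • (0 : EE d)) / u - k (u • z) / u ≤ C * ‖z‖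
      rw [← sub_div, div_le_iff₀ hu0]
      have h2 := hC.dist_le_mul (u • (0 : EE d)) (u • z)
      rw [Real.dist_eq, dist_eq_norm, smul_zero, zero_sub, norm_neg, norm_smul, Real.norm_of_nonneg hu0.le] at h2
      rw [smul_zero]
      nlinarith [le_abs_self (k 0 - k (u • z))]
    · exact integrableOn_const (by simp)
  refine h1.trans ?_
  rw [setIntegral_const, Measure.real, Real.volume_Icc, ENNReal.toReal_ofReal (by linarith [Real.one_le_exp ht]), smul_eq_mul]
  have : 0 ≤ (C : ℝ) * ‖z‖ := by positivity
  nlinarith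

lemma KK_stab {k : EE d → ℝ} {R : ℝ} (hR : ∀ z, R ≤ ‖z‖ → k z = 0) {s t : ℝ} (hst : s ≤ t) {z : EE d}
    (hz : R ≤ Real.exp s * ‖z‖) : KK k t z = KK k s z := by
  unfold KK
  apply setIntegral_eq_of_subset_of_forall_sdiff_eq_zero measurableSet_Icc
  · exact Set.Icc_subset_Icc_right (Real.exp_le_exp.2 hst)
  · intro u hu
    have h1 : Real.exp s < u := by
      by_contra h
      exact hu.2 ⟨hu.1.1, not_lt.1 h⟩
    rw [hR, zero_div]
    have : 0 < u := (Real.exp_pos s).trans h1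
    rw [norm_smul, Real.norm_of_nonneg this.le]
    nlinarith [norm_nonneg z]

end

section
variable {Ω : Type*} [MeasurableSpace Ω] {P : Measure Ω} [IsProbabilityMeasure P]

lemma gau_memLp {Z : Ω → ℝ} (hZ : Measurable Z) {v : NNReal} (h : P.map Z = gaussianReal 0 v) :
    MemLp Z 2 P := by
  have h1 : MemLp id 2 (P.map Z) := by rw [h]; exact memLp_id_gaussianReal 2
  exact (memLp_map_measure_iff (by fun_prop) hZ.aemeasurable).1 h1

lemma gau_var {Z : Ω → ℝ} (hZ : Measurable Z) {v : NNReal} (h : P.map Z = gaussianReal 0 v) :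
    ∫ ω, Z ω * Z ω ∂P = v := by
  have h1 : ∫ x, x * x ∂(P.map Z) = ∫ ω, Z ω * Z ω ∂P :=
    integral_map hZ.aemeasurable (by fun_prop)
  rw [← h1, h]
  have h2 := variance_fun_id_gaussianReal (μ := 0) (v := v)
  rw [variance_eq_integral (by fun_prop)] at h2
  rw [integral_id_gaussianReal] at h2
  rw [← h2]
  congr 1
  ext x
  ring
end


structure XH (d : ℕ) {Ω : Type*} [MeasurableSpace Ω] (P : Measure Ω) (k : EE d → ℝ)
    (X : ℝ → EE d → Ω → ℝ) : Prop where
  meas : ∀ t x, Measurable (X t x)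
  gauss : ∀ (n : ℕ) (c : Fin n → ℝ) (t : Fin n → ℝ) (x : Fin n → EE d),
      ∃ v : NNReal, Measure.map (fun ω => ∑ i, c i * X (t i) (x i) ω) P = gaussianReal 0 v
  cent : ∀ t x, ∫ ω, X t x ω ∂P = 0
  cov : ∀ t, 0 ≤ t → ∀ x y : EE d, ∫ ω, X t x ω * X t y ω ∂P = KK k t (x - y)
  indep : ∀ s t : ℝ, 0 ≤ s → s < t →
      Indep (⨆ x : EE d, MeasurableSpace.comap (fun ω => X t x ω - X s x ω) inferInstance)
        (⨆ u ∈ Set.Icc (0:ℝ) s, ⨆ x : EE d, MeasurableSpace.comap (X u x) inferInstance) P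

section
set_option linter.unusedSectionVars false
variable {d : ℕ} {Ω : Type*} [MeasurableSpace Ω] {P : Measure Ω} [IsProbabilityMeasure P]
  {k : EE d → ℝ} {X : ℝ → EE d → Ω → ℝ}

lemma XH.memLp (h : XH d P k X) (t : ℝ) (x : EE d) : MemLp (X t x) 2 P := by
  obtain ⟨v, hv⟩ := h.gauss 1 (fun _ => 1) (fun _ => t) (fun _ => x)
  simp only [Finset.univ_unique, Finset.sum_const, Finset.card_singleton, one_smul, one_mul] at hv
  exact gau_memLp (h.meas t x) hv

lemma XH.gauss2 (h : XH d P k X) (a b t s : ℝ) (x y : EE d) :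
    ∃ v : NNReal, P.map (fun ω => a * X t x ω + b * X s y ω) = gaussianReal 0 v := by
  obtain ⟨v, hv⟩ := h.gauss 2 ![a, b] ![t, s] ![x, y]
  refine ⟨v, ?_⟩
  simpa [Fin.sum_univ_succ] using hv

lemma XH.gauss4 (h : XH d P k X) (a b t s : ℝ) (x y : EE d) :
    ∃ v : NNReal, P.map (fun ω => a * (X t x ω - X s x ω) + b * (X t y ω - X s y ω)) = gaussianReal 0 v := by
  obtain ⟨v, hv⟩ := h.gauss 4 ![a, -a, b, -b] ![t, s, t, s] ![x, x, y, y]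
  refine ⟨v, ?_⟩
  rw [← hv]
  congr 1
  ext ω
  simp [Fin.sum_univ_succ]
  ring

lemma XH.pair_indep (h : XH d P k X) (n : ℕ) (x y : EE d) :
    IndepFun (fun ω => (X (n+1 : ℝ) x ω - X n x ω, X (n+1 : ℝ) y ω - X n y ω))
    (fun ω => ((fun (j : ℕ) => X (min j n : ℕ) x ω), (fun (j : ℕ) => X (min j n : ℕ) y ω))) P := by
  have h0 := h.indep n (n+1) (by positivity) (by linarith)
  rw [IndepFun_iff_Indep]
  refine indep_of_indep_of_le_left (indep_of_indep_of_le_right h0 ?_) ?_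
  · rw [← measurable_iff_comap_le]
    have key : ∀ (j : ℕ) (z : EE d), Measurable[⨆ u ∈ Set.Icc (0:ℝ) n, ⨆ x : EE d, MeasurableSpace.comap (X u x) inferInstance] (X (min j n : ℕ) z) := by
      intro j z
      rw [measurable_iff_comap_le]
      refine le_trans ?_ (le_iSup₂ (f := fun (u : ℝ) (_ : u ∈ Set.Icc (0:ℝ) n) => ⨆ x : EE d, MeasurableSpace.comap (X u x) inferInstance) ((min j n : ℕ) : ℝ) ⟨by positivity, by exact_mod_cast min_le_right j n⟩)
      exact le_iSup (fun x : EE d => MeasurableSpace.comap (X (min j n : ℕ) x) inferInstance) z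
    refine Measurable.prodMk ?_ ?_
    · exact @measurable_pi_lambda _ _ _ (_) _ _ fun j => key j x
    · exact @measurable_pi_lambda _ _ _ (_) _ _ fun j => key j y
  · rw [← measurable_iff_comap_le]
    have key : ∀ (z : EE d), Measurable[⨆ x : EE d, MeasurableSpace.comap (fun ω => X (n+1 : ℝ) x ω - X n x ω) inferInstance] (fun ω => X (n+1 : ℝ) z ω - X n z ω) := by
      intro z
      rw [measurable_iff_comap_le]
      exact le_iSup (fun x : EE d => MeasurableSpace.comap (fun ω => X (n+1 : ℝ) x ω - X n x ω) inferInstance) z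
    exact Measurable.prodMk (key x) (key y)

lemma XH.inc_indep (h : XH d P k X) (n : ℕ) (x : EE d) :
    IndepFun (fun ω => X (n+1 : ℝ) x ω - X n x ω) (fun ω (j : ℕ) => X (min j n : ℕ) x ω) P :=
  (h.pair_indep n x x).comp measurable_fst measurable_fst

lemma XH.inc_mul (h : XH d P k X) (n : ℕ) (x y : EE d) :
    ∫ ω, (X (n+1 : ℝ) x ω - X n x ω) * X n y ω ∂P = 0 := by
  have h1 : IndepFun (fun ω => X (n+1 : ℝ) x ω - X n x ω) (X n y) P := by
    have := (h.pair_indep n x y).comp (φ := Prod.fst) (ψ := fun p => p.2 n) measurable_fst (by fun_prop)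
    simpa [Function.comp_def] using this
  have h2 := h1.integral_mul_eq_mul_integral
    ((h.meas _ _).sub (h.meas _ _)).aestronglyMeasurable (h.meas _ _).aestronglyMeasurable
  rw [h.cent, mul_zero] at h2
  exact h2

lemma XH.inc_cov (h : XH d P k X) (n : ℕ) (x y : EE d) :
    ∫ ω, (X (n+1 : ℝ) x ω - X n x ω) * (X (n+1 : ℝ) y ω - X n y ω) ∂P
      = KK k (n+1 : ℝ) (x - y) - KK k n (x - y) := by
  have i : ∀ {f g : Ω → ℝ}, MemLp f 2 P → MemLp g 2 P → Integrable (fun ω => f ω * g ω) P :=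
    fun hf hg => hf.integrable_mul hg
  have e1 := h.cov (n+1) (by positivity) x y
  have e2 := h.cov n (by positivity) x y
  have e3 := h.inc_mul n x y
  have e4 := h.inc_mul n y x
  have m := h.memLp
  have e : ∀ ω, (X (n+1 : ℝ) x ω - X n x ω) * (X (n+1 : ℝ) y ω - X n y ω)
    = X (n+1 : ℝ) x ω * X (n+1 : ℝ) y ω - X n x ω * X n y ω - (X (n+1 : ℝ) x ω - X n x ω) * X n y ω
      - (X (n+1 : ℝ) y ω - X n y ω) * X n x ω := fun ω => by ring
  simp_rw [e]
  rw [integral_sub, integral_sub, integral_sub, e1, e2, e3, e4]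
  · ring
  · exact i (m _ _) (m _ _)
  · exact i (m _ _) (m _ _)
  · exact (i (m _ _) (m _ _)).sub (i (m _ _) (m _ _))
  · exact i ((m _ _).sub (m _ _)) (m _ _)
  · exact ((i (m _ _) (m _ _)).sub (i (m _ _) (m _ _))).sub (i ((m _ _).sub (m _ _)) (m _ _))
  · exact i ((m _ _).sub (m _ _)) (m _ _)

lemma XH.inc_law (h : XH d P k X) (hk0 : k 0 = 1) (n : ℕ) (x : EE d) :
    P.map (fun ω => X (n+1 : ℝ) x ω - X n x ω) = gam := by
  obtain ⟨v, hv⟩ := h.gauss4 1 0 (n+1) n x x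
  simp only [one_mul, zero_mul, add_zero] at hv
  have h1 := gau_var ((h.meas _ _).sub (h.meas _ _)) hv
  have h2 := h.inc_cov n x x
  rw [sub_self, KK_zero hk0 (by positivity), KK_zero hk0 (by positivity)] at h2
  have h1 := h2.symm.trans h1
  have : v = 1 := by
    apply NNReal.eq
    rw [← h1]; push_cast; ring
  rw [hv, this]

lemma XH.pair_law (h : XH d P k X) (hk0 : k 0 = 1) {R : ℝ} (hR : ∀ z, R ≤ ‖z‖ → k z = 0) (n : ℕ) (x y : EE d)
    (hxy : R ≤ Real.exp (n : ℝ) * ‖x - y‖) :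
    P.map (fun ω => (X (n+1 : ℝ) x ω - X n x ω, X (n+1 : ℝ) y ω - X n y ω)) = gam.prod gam := by
  have mx : ∀ x, Measurable (fun ω => X (n+1 : ℝ) x ω - X n x ω) := fun x => (h.meas _ _).sub (h.meas _ _)
  have mm : ∀ x, MemLp (fun ω => X (n+1 : ℝ) x ω - X n x ω) 2 P := fun x => (h.memLp _ _).sub (h.memLp _ _)
  have hg : HasGaussianLaw (fun ω => (X (n+1 : ℝ) x ω - X n x ω, X (n+1 : ℝ) y ω - X n y ω)) P := by
    refine ⟨?_⟩
    apply isGaussian_of_map_eq_gaussianReal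
    intro L
    obtain ⟨v, hv⟩ := h.gauss4 (L (1, 0)) (L (0, 1)) (n+1) n x y
    refine ⟨0, v, ?_⟩
    rw [← hv, Measure.map_map (by fun_prop) ((mx x).prodMk (mx y))]
    congr 1
    ext ω
    have : ∀ a b : ℝ, L (a, b) = L (1, 0) * a + L (0, 1) * b := by
      intro a b
      have : (a, b) = a • ((1 : ℝ), (0 : ℝ)) + b • ((0 : ℝ), (1 : ℝ)) := by simp
      rw [this, map_add, map_smul, map_smul, smul_eq_mul, smul_eq_mul]
      ring
    exact this _ _
  have hc : cov[fun ω => X (n+1 : ℝ) x ω - X n x ω, fun ω => X (n+1 : ℝ) y ω - X n y ω; P] = 0 := by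
    rw [covariance_eq_sub (mm x) (mm y)]
    have e1 : ∫ ω, (X (n+1 : ℝ) x ω - X n x ω) ∂P = 0 := by
      rw [integral_sub ((h.memLp _ _).integrable (by norm_num)) ((h.memLp _ _).integrable (by norm_num)), h.cent, h.cent, sub_zero]
    rw [e1, zero_mul, sub_zero]
    have e2 := h.inc_cov n x y
    rw [KK_stab hR (by linarith) hxy, sub_self] at e2
    exact e2
  have hi := hg.indepFun_of_covariance_eq_zero hc
  rw [(indepFun_iff_map_prod_eq_prod_map_map (mx x).aemeasurable (mx y).aemeasurable).1 hi,
    h.inc_law hk0, h.inc_law hk0]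

lemma XH.zero (h : XH d P k X) (hk0 : k 0 = 1) (x : EE d) : ∀ᵐ ω ∂P, X 0 x ω = 0 := by
  have h1 := h.cov 0 le_rfl x x
  rw [sub_self, KK_zero hk0 le_rfl] at h1
  have h2 := (integral_eq_zero_iff_of_nonneg (fun ω => mul_self_nonneg _) ((h.memLp 0 x).integrable_mul (h.memLp 0 x))).1 h1
  filter_upwards [h2] with ω hω
  simpa using hω

lemma XH.mgf (h : XH d P k X) (hkc : Continuous k) (hk0 : k 0 = 1) {C : NNReal} (hC : LipschitzWith C k)
    (n : ℕ) (y y' : EE d) (lam : ℝ) (hl : 0 ≤ lam) :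
    ∫⁻ ω, ENNReal.ofReal (Real.exp (√(2 * d) * X n y ω + lam * (X n y ω - X n y' ω))) ∂P
      ≤ ENNReal.ofReal (Real.exp (d * n + (√(2 * d) * lam + lam ^ 2) * (C * (Real.exp n * ‖y - y'‖)))) := by
  obtain ⟨v, hv⟩ := h.gauss2 (√(2 * d) + lam) (-lam) n n y y'
  have mZ : Measurable (fun ω => (√(2 * d) + lam) * X n y ω + (-lam) * X n y' ω) :=
    ((h.meas _ _).const_mul _).add ((h.meas _ _).const_mul _)
  have h1 := gau_var mZ hv
  have i : ∀ x y, Integrable (fun ω => X n x ω * X n y ω) P :=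
    fun x y => (h.memLp n x).integrable_mul (h.memLp n y)
  have hn : (0:ℝ) ≤ n := by positivity
  have e1 := h.cov n hn y y
  have e2 := h.cov n hn y' y'
  have e3 := h.cov n hn y y'
  rw [sub_self, KK_zero hk0 hn] at e1 e2
  have h2 : (v : ℝ) = (√(2 * d) + lam) ^ 2 * n + (-(2 * (√(2 * d) + lam) * lam)) * KK k n (y - y') + lam ^ 2 * n := by
    have e : ∀ ω, ((√(2 * d) + lam) * X n y ω + (-lam) * X n y' ω) * ((√(2 * d) + lam) * X n y ω + (-lam) * X n y' ω)
      = (√(2 * d) + lam) ^ 2 * (X n y ω * X n y ω) + (-(2 * (√(2 * d) + lam) * lam)) * (X n y ω * X n y' ω) + lam ^ 2 * (X n y' ω * X n y' ω) := fun ω => by ring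
    refine h1.symm.trans ?_
    rw [integral_congr_ae (ae_of_all _ e)]
    rw [integral_add, integral_add, integral_const_mul, integral_const_mul, integral_const_mul, e1, e2, e3]
    · exact (i _ _).const_mul _
    · exact (i _ _).const_mul _
    · exact ((i _ _).const_mul _).add ((i _ _).const_mul _)
    · exact (i _ _).const_mul _
  have h3 := mgf_gaussianReal hv 1
  have h4 : Integrable (fun ω => Real.exp (1 * ((√(2 * d) + lam) * X n y ω + (-lam) * X n y' ω))) P := by
    have := integrable_exp_mul_gaussianReal (μ := 0) (v := v) 1
    rw [← hv] at this
    exact (integrable_map_measure (by fun_prop) mZ.aemeasurable).1 this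
  have h5 : ∀ ω, √(2 * d) * X n y ω + lam * (X n y ω - X n y' ω) = 1 * ((√(2 * d) + lam) * X n y ω + (-lam) * X n y' ω) := fun ω => by ring
  simp_rw [h5]
  rw [← ofReal_integral_eq_lintegral_ofReal h4 (ae_of_all _ fun ω => (Real.exp_pos _).le)]
  apply ENNReal.ofReal_le_ofReal
  unfold ProbabilityTheory.mgf at h3
  rw [h3]
  apply Real.exp_le_exp.2
  have hs : √(2 * d) ^ 2 = 2 * d := Real.sq_sqrt (by positivity)
  have hs0 : 0 ≤ √(2 * (d : ℝ)) := Real.sqrt_nonneg _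
  have h6 := KK_lip hkc hk0 hC hn (y - y')
  have h7 : 0 ≤ √(2 * (d : ℝ)) * lam + lam ^ 2 := by positivity
  have h8 := mul_le_mul_of_nonneg_left h6 h7
  have h9 : (0 : ℝ) * 1 + v * 1 ^ 2 / 2 = d * n + (√(2 * (d : ℝ)) * lam + lam ^ 2) * (n - KK k n (y - y')) := by
    rw [h2]
    linear_combination (n / 2 : ℝ) * hs
  rw [h9]
  linarith

lemma XH.toDW (h : XH d P k X) (hkc : Continuous k) (hk0 : k 0 = 1) {C : NNReal} (hC : LipschitzWith C k)
    {R : ℝ} (hR : ∀ z, R ≤ ‖z‖ → k z = 0)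
    (hcont : ∀ᵐ ω ∂P, Continuous fun p : ℝ × EE d => X p.1 p.2 ω) :
    ∃ S : ℕ → EE d → Ω → ℝ, DW d P S R C ∧ ∀ᵐ ω ∂P, ∀ n x, S n x ω = X n x ω := by
  obtain ⟨t, ht1, ht2, ht3⟩ := exists_measurable_superset_of_null (ae_iff.1 hcont)
  have hae : ∀ᵐ ω ∂P, ∀ (n : ℕ) x, tᶜ.indicator (X n x) ω = X n x ω := by
    have : ∀ᵐ ω ∂P, ω ∉ t := measure_eq_zero_iff_ae_notMem.1 ht3
    filter_upwards [this] with ω hω n x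
    exact Set.indicator_of_mem (by exact hω) _
  refine ⟨fun n x => tᶜ.indicator (X n x), ?_, hae⟩
  refine ⟨?_, ?_, ?_, ?_, ?_, ?_, ?_, ?_⟩
  · exact fun n x => (h.meas _ _).indicator ht2.compl
  · intro n ω
    by_cases hω : ω ∈ t
    · have : (fun x => tᶜ.indicator (X n x) ω) = fun _ => 0 := by
        ext x
        exact Set.indicator_of_notMem (by simpa using hω) _
      rw [this]
      exact continuous_const
    · have : (fun x => tᶜ.indicator (X n x) ω) = fun x => X n x ω := by
        ext x
        exact Set.indicator_of_mem (by exact hω) _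
      rw [this]
      have hc : Continuous fun p : ℝ × EE d => X p.1 p.2 ω := by
        by_contra hc
        exact hω (ht1 hc)
      exact hc.comp (by fun_prop : Continuous fun x : EE d => ((n : ℝ), x))
  · intro x
    filter_upwards [hae, h.zero hk0 x] with ω h1 h2
    rw [h1]
    simpa using h2
  · intro n x
    rw [← h.inc_law hk0 n x]
    apply Measure.map_congr
    filter_upwards [hae] with ω h1
    simp only [h1]
    push_cast
    rfl
  · intro n x
    refine (h.inc_indep n x).congr ?_ ?_
    · filter_upwards [hae] with ω h1
      simp only [h1]
      push_cast
      rfl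
    · filter_upwards [hae] with ω h1
      simp only [h1]
  · intro n x y hxy
    rw [← h.pair_law hk0 hR n x y hxy]
    apply Measure.map_congr
    filter_upwards [hae] with ω h1
    simp only [h1]
    push_cast
    rfl
  · intro n x y
    refine (h.pair_indep n x y).congr ?_ ?_
    · filter_upwards [hae] with ω h1
      simp only [h1]
      push_cast
      rfl
    · filter_upwards [hae] with ω h1
      simp only [h1]
  · intro n y y' lam hl
    refine le_trans (le_of_eq ?_) (h.mgf hkc hk0 hC n y y' lam hl)
    apply lintegral_congr_ae
    filter_upwards [hae] with ω h1
    simp only [h1]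

end

theorem derivative_measure_atomless
    {d : ℕ} (hd : 1 ≤ d)
    {Ω : Type*} [m0 : MeasurableSpace Ω] (P : Measure Ω) [IsProbabilityMeasure P]
    (k : EuclideanSpace ℝ (Fin d) → ℝ)
    (hk1 : ContDiff ℝ 1 k) (hk0 : k 0 = 1) (hkb : ∀ z, |k z| ≤ 1)
    (hksupp : HasCompactSupport k)
    (hkpd : ∀ (n : ℕ) (z : Fin n → EuclideanSpace ℝ (Fin d)) (c : Fin n → ℝ),
      0 ≤ ∑ i, ∑ j, c i * c j * k (z i - z j))
    (X : ℝ → EuclideanSpace ℝ (Fin d) → Ω → ℝ)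
    (hXmeas : ∀ t x, Measurable (X t x))
    (hXgauss : ∀ (n : ℕ) (c : Fin n → ℝ) (t : Fin n → ℝ)
        (x : Fin n → EuclideanSpace ℝ (Fin d)),
      ∃ v : NNReal,
        Measure.map (fun ω => ∑ i, c i * X (t i) (x i) ω) P = gaussianReal 0 v)
    (hXcent : ∀ t x, ∫ ω, X t x ω ∂P = 0)
    (hXcov : ∀ t, 0 ≤ t → ∀ x y : EuclideanSpace ℝ (Fin d),
      ∫ ω, X t x ω * X t y ω ∂P = ∫ u in Set.Icc (1:ℝ) (Real.exp t), k (u • (x - y)) / u)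
    (hXcont : ∀ᵐ ω ∂P, Continuous fun p : ℝ × EuclideanSpace ℝ (Fin d) => X p.1 p.2 ω)
    (hXindep : ∀ s t : ℝ, 0 ≤ s → s < t →
      Indep (⨆ x : EuclideanSpace ℝ (Fin d),
          MeasurableSpace.comap (fun ω => X t x ω - X s x ω) inferInstance)
        (⨆ u ∈ Set.Icc (0:ℝ) s, ⨆ x : EuclideanSpace ℝ (Fin d),
          MeasurableSpace.comap (X u x) inferInstance) P)
    :
    ∀ᵐ ω ∂P, ∀ μ : Measure (EuclideanSpace ℝ (Fin d)),
      IsLocallyFiniteMeasure μ →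
      (∀ f : EuclideanSpace ℝ (Fin d) → ℝ, Continuous f → HasCompactSupport f →
        Tendsto (fun t : ℝ =>
            ∫ x, f x * ((Real.sqrt (2 * (d:ℝ)) * t - X t x ω) *
              Real.exp (Real.sqrt (2 * (d:ℝ)) * X t x ω - (d:ℝ) * t)))
          atTop (nhds (∫ x, f x ∂μ))) →
      ∀ x : EuclideanSpace ℝ (Fin d), μ {x} = 0 := by
  have hX : XH d P k X := ⟨hXmeas, hXgauss, hXcent, hXcov, hXindep⟩
  obtain ⟨C, hC⟩ := ContDiff.lipschitzWith_of_hasCompactSupport hksupp hk1 (by simp)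
  obtain ⟨R0, hR0⟩ := hksupp.isCompact.isBounded.subset_ball (0 : EE d)
  have hR : ∀ z, max R0 1 ≤ ‖z‖ → k z = 0 := by
    intro z hz
    by_contra h
    have h1 := hR0 (subset_tsupport k (Function.mem_support.2 h))
    rw [mem_ball_zero_iff] at h1
    exact absurd ((le_max_left R0 1).trans hz) (not_le.2 h1)
  have hRpos : 0 < max R0 1 := lt_of_lt_of_le one_pos (le_max_right _ _)
  obtain ⟨S, h, hS⟩ := hX.toDW hk1.continuous hk0 hC hR hXcont
  obtain ⟨A, hA, hG⟩ := exA1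
  have h1 : ∀ᵐ ω ∂P, ∀ J b : ℕ, ⨅ m0 : ℕ, liminf (fun N => II S (max R0 1) A (b : ℝ) ((J : ℝ) + 1) N m0 ω) atTop = 0 := by
    rw [ae_all_iff]
    intro J
    rw [ae_all_iff]
    intro b
    exact h.second hd hRpos A hA hG b (by positivity) _
  have h2 : ∀ᵐ ω ∂P, ∀ J : ℕ, ∃ b : ℕ, ∀ n : ℕ, ∀ x ∈ Qc d ((J : ℝ) + 1), 0 ≤ √(2 * d) * n - S n x ω + b := by
    rw [ae_all_iff]
    intro J
    exact h.barrier hd C.coe_nonneg (by positivity)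
  filter_upwards [hS, h1, h2] with ω hSω h1ω h2ω
  intro μ hμ hconv x
  obtain ⟨J, hJ⟩ := exists_nat_gt ‖x‖
  obtain ⟨b, hb⟩ := h2ω J
  refine h.path_end hRpos A hA (b : ℝ) (by positivity) ω hb (h1ω J b) μ hμ ?_ x ?_
  · intro f hf hfs
    have := (hconv f hf hfs).comp tendsto_natCast_atTop_atTop
    simp_rw [hSω]
    exact this
  · rw [mem_ball_zero_iff]
    linarith
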